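/- Let a functional PTS be given, with corresponding EPTS, and let |·| be the natural erasure from EPTS terms to PTS terms (removing the sort and type annotations on λ, @ and Π). Define M ≡_I N iff |M| = |N| and M ≡ N in the EPTS. If Γ ⊢_PTS A type, then there exist an EPTS context Γ' and EPTS term A' with |Γ'| = Γ and |A'| = A such that there is a bijection between the set of PTS terms M with Γ ⊢_PTS M : A and the quotient by ≡_I of the set of EPTS terms M' with Γ' ⊢_EPTS M' : A'. -/

import Mathlib

namespace DKPaper

inductive Tm (C : Type) : Type
  | var : Nat → Tm C
  | const : C → List (Tm C) → Tm C
  | type : Tm C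
  | kind : Tm C
  | app : Tm C → Tm C → Tm C
  | lam : Tm C → Tm C → Tm C
  | pi : Tm C → Tm C → Tm C

namespace Tm
variable {C : Type}

def liftRen (ρ : Nat → Nat) : Nat → Nat
  | 0 => 0
  | n + 1 => ρ n + 1

def ren (ρ : Nat → Nat) : Tm C → Tm C
  | var n => var (ρ n)
  | const c Ms => const c (Ms.attach.map fun x => ren ρ x.1)
  | type => type
  | kind => kind
  | app M N => app (ren ρ M) (ren ρ N)
  | lam A M => lam (ren ρ A) (ren (liftRen ρ) M)
  | pi A B => pi (ren ρ A) (ren (liftRen ρ) B)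
termination_by t => sizeOf t
decreasing_by
  all_goals simp_wf
  all_goals try omega
  all_goals (have h := List.sizeOf_lt_of_mem x.2; omega)

def liftSub (σ : Nat → Tm C) : Nat → Tm C
  | 0 => var 0
  | n + 1 => ren Nat.succ (σ n)

def sub (σ : Nat → Tm C) : Tm C → Tm C
  | var n => σ n
  | const c Ms => const c (Ms.attach.map fun x => sub σ x.1)
  | type => type
  | kind => kind
  | app M N => app (sub σ M) (sub σ N)
  | lam A M => lam (sub σ A) (sub (liftSub σ) M)
  | pi A B => pi (sub σ A) (sub (liftSub σ) B)
termination_by t => sizeOf t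
decreasing_by
  all_goals simp_wf
  all_goals try omega
  all_goals (have h := List.sizeOf_lt_of_mem x.2; omega)

/-- Substitution of `N` for the variable of de Bruijn index `k` (the usual `M{N/x}`). -/
def substAt (k : Nat) (N : Tm C) : Tm C → Tm C :=
  sub fun n => if n < k then var n else if n = k then ren (· + k) N else var (n - 1)

end Tm

/-! ## Signatures, rewrite rules, rewriting -/

/-- An entry `c[Δ] : A` of a signature: head constant, telescope (in declaration
order, each entry a type under the previous ones), and the type. -/
abbrev Sig (C : Type) := Set (C × List (Tm C) × Tm C)

/-- A rewrite rule `c[l⃗] ↪ r`: head constant, list of left-hand side argument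
patterns (free de Bruijn variables are the pattern variables), right-hand side. -/
abbrev Rules (C : Type) := Set (C × List (Tm C) × Tm C)

variable {C : Type}

/-- Closure of a root relation under all term-forming contexts. -/
inductive Cong (r : Tm C → Tm C → Prop) : Tm C → Tm C → Prop
  | base {M N} : r M N → Cong r M N
  | appL {M M' N} : Cong r M M' → Cong r (.app M N) (.app M' N)
  | appR {M N N'} : Cong r N N' → Cong r (.app M N) (.app M N')
  | lamA {A A' M} : Cong r A A' → Cong r (.lam A M) (.lam A' M)
  | lamM {A M M'} : Cong r M M' → Cong r (.lam A M) (.lam A M')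
  | piA {A A' B} : Cong r A A' → Cong r (.pi A B) (.pi A' B)
  | piB {A B B'} : Cong r B B' → Cong r (.pi A B) (.pi A B')
  | constArg {c l₁ M M' l₂} : Cong r M M' →
      Cong r (.const c (l₁ ++ M :: l₂)) (.const c (l₁ ++ M' :: l₂))

/-- Root β-reduction. -/
def BetaRoot : Tm C → Tm C → Prop := fun M N =>
  ∃ A P Q, M = .app (.lam A P) Q ∧ N = Tm.substAt 0 Q P

/-- Root reduction by a rule of `R`: a substitution instance of some rule. -/
def RuleRoot (R : Rules C) : Tm C → Tm C → Prop := fun M N =>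
  ∃ rl ∈ R, ∃ σ : Nat → Tm C,
    M = Tm.sub σ (.const rl.1 rl.2.1) ∧ N = Tm.sub σ rl.2.2

/-- One-step β-reduction `↪_β`. -/
def Beta : Tm C → Tm C → Prop := Cong BetaRoot

/-- One-step reduction by the rules of `R` only (no β). -/
def RStep (R : Rules C) : Tm C → Tm C → Prop := Cong (RuleRoot R)

/-- One-step reduction `↪_{β𝓡}`. -/
def Step (R : Rules C) : Tm C → Tm C → Prop :=
  Cong (fun M N => BetaRoot M N ∨ RuleRoot R M N)

/-- The conversion `≡_{β𝓡}` generated by `↪_{β𝓡}`. -/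
def Conv (R : Rules C) : Tm C → Tm C → Prop := Relation.EqvGen (Step R)

/-- Confluence of an abstract reduction relation. -/
def Confluent {α : Type _} (r : α → α → Prop) : Prop :=
  ∀ a b c, Relation.ReflTransGen r a b → Relation.ReflTransGen r a c →
    ∃ d, Relation.ReflTransGen r b d ∧ Relation.ReflTransGen r c d

/-- `M` is in β-normal form. -/
def BetaNormal (M : Tm C) : Prop := ∀ N, ¬ Beta M N

/-- Strong normalization of a relation at a point: no infinite `r`-sequence starts at `a`. -/
def SN {α : Type _} (r : α → α → Prop) (a : α) : Prop := Acc (fun x y => r y x) a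


/-! ## Dedukti typing -/

/-- `IsDKSort s` means `s` is `TYPE` or `KIND`. -/
def IsDKSort (s : Tm C) : Prop := s = Tm.type ∨ s = Tm.kind

/-- `A{M⃗}`: simultaneous instantiation of the telescope variables by the arguments. -/
def instArgs (Ms : List (Tm C)) (A : Tm C) : Tm C :=
  Tm.sub (fun n => Ms.reverse.getD n (Tm.var (n - Ms.length))) A

/-- Instantiate the first variable of the (remaining) telescope `Δ` with `M`. -/
def instTele (M : Tm C) (Δ : List (Tm C)) : List (Tm C) :=
  Δ.mapIdx fun i B => Tm.substAt i M B

mutual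
/-- Well-formed contexts `Σ;Γ well-formed` (de Bruijn: last declaration first). -/
inductive Wf (S : Sig C) (R : Rules C) : List (Tm C) → Prop
  | empty : Wf S R []
  | decl {Γ A} : Typed S R Γ A Tm.type → Wf S R (A :: Γ)

/-- The Dedukti typing judgment `Σ;Γ ⊢ M : A`. -/
inductive Typed (S : Sig C) (R : Rules C) : List (Tm C) → Tm C → Tm C → Prop
  | sort {Γ} : Wf S R Γ → Typed S R Γ Tm.type Tm.kind
  | var {Γ n A} : Wf S R Γ → Γ[n]? = some A →
      Typed S R Γ (Tm.var n) (Tm.ren (· + (n + 1)) A)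
  | cons {Γ c Δ A s Ms} : (c, Δ, A) ∈ S → Typed S R Δ.reverse A s → IsDKSort s →
      TypedArgs S R Γ Ms Δ → Typed S R Γ (Tm.const c Ms) (instArgs Ms A)
  | conv {Γ M A B s} : Typed S R Γ M A → Typed S R Γ B s → IsDKSort s →
      Conv R A B → Typed S R Γ M B
  | prod {Γ A B s} : Typed S R Γ A Tm.type → Typed S R (A :: Γ) B s → IsDKSort s →
      Typed S R Γ (Tm.pi A B) s
  | abs {Γ A B s M} : Typed S R Γ A Tm.type → Typed S R (A :: Γ) B s → IsDKSort s →
      Typed S R (A :: Γ) M B → Typed S R Γ (Tm.lam A M) (Tm.pi A B)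
  | app {Γ M N A B} : Typed S R Γ M (Tm.pi A B) → Typed S R Γ N A →
      Typed S R Γ (Tm.app M N) (Tm.substAt 0 N B)

/-- `Σ;Γ ⊢ M⃗ : Δ`: the arguments fit the telescope. -/
inductive TypedArgs (S : Sig C) (R : Rules C) : List (Tm C) → List (Tm C) → List (Tm C) → Prop
  | nil {Γ} : TypedArgs S R Γ [] []
  | cons {Γ M Ms A Δ} : Typed S R Γ M A → TypedArgs S R Γ Ms (instTele M Δ) →
      TypedArgs S R Γ (M :: Ms) (A :: Δ)
end

/-! ## Type-level and object-level constants, syntactic classes -/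

/-- Types of the form `Πx⃗:B⃗.TYPE`. -/
inductive IsKindShape : Tm C → Prop
  | type : IsKindShape Tm.type
  | pi {A K} : IsKindShape K → IsKindShape (Tm.pi A K)

/-- `c` is a type-level constant of the signature `S`. -/
def TypeLevel (S : Sig C) (c : C) : Prop := ∃ Δ A, (c, Δ, A) ∈ S ∧ IsKindShape A

/-- `c` is an object-level constant of the signature `S`: it is declared, and not type-level. -/
def ObjLevel (S : Sig C) (c : C) : Prop := (∃ Δ A, (c, Δ, A) ∈ S) ∧ ¬ TypeLevel S c

mutual
/-- Kinds: `K ::= TYPE | Πx:T.K`. -/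
inductive IsKind (S : Sig C) : Tm C → Prop
  | type : IsKind S Tm.type
  | pi {T K} : IsTypeFam S T → IsKind S K → IsKind S (Tm.pi T K)

/-- Type families: `T ::= α[O⃗] | T O | λx:T.T | Πx:T.T` with `α` type-level. -/
inductive IsTypeFam (S : Sig C) : Tm C → Prop
  | const {c Os} : TypeLevel S c → (∀ O ∈ Os, IsObj S O) → IsTypeFam S (Tm.const c Os)
  | app {T O} : IsTypeFam S T → IsObj S O → IsTypeFam S (Tm.app T O)
  | lam {T₁ T₂} : IsTypeFam S T₁ → IsTypeFam S T₂ → IsTypeFam S (Tm.lam T₁ T₂)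
  | pi {T₁ T₂} : IsTypeFam S T₁ → IsTypeFam S T₂ → IsTypeFam S (Tm.pi T₁ T₂)

/-- Objects: `O ::= x | a[O⃗] | O O | λx:T.O` with `a` object-level. -/
inductive IsObj (S : Sig C) : Tm C → Prop
  | var {n} : IsObj S (Tm.var n)
  | const {c Os} : ObjLevel S c → (∀ O ∈ Os, IsObj S O) → IsObj S (Tm.const c Os)
  | app {O₁ O₂} : IsObj S O₁ → IsObj S O₂ → IsObj S (Tm.app O₁ O₂)
  | lam {T O} : IsTypeFam S T → IsObj S O → IsObj S (Tm.lam T O)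
end

mutual
/-- Pre-kinds: `L ::= TYPE | Πx:R.L`. -/
inductive PreKind (S : Sig C) : Tm C → Prop
  | type : PreKind S Tm.type
  | pi {R L} : PreTypeFam S R → PreKind S L → PreKind S (Tm.pi R L)

/-- Pre-type families: `R ::= α[M⃗] | R N | λx:A.R | Πx:R.R` with `α` type-level
and `M⃗`, `N`, `A` arbitrary. -/
inductive PreTypeFam (S : Sig C) : Tm C → Prop
  | const {c Ms} : TypeLevel S c → PreTypeFam S (Tm.const c Ms)
  | app {R N} : PreTypeFam S R → PreTypeFam S (Tm.app R N)
  | lam {A R} : PreTypeFam S R → PreTypeFam S (Tm.lam A R)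
  | pi {R₁ R₂} : PreTypeFam S R₁ → PreTypeFam S R₂ → PreTypeFam S (Tm.pi R₁ R₂)
end

/-- A rewrite rule is type-level when its head constant is type-level. -/
def TypeLevelRule (S : Sig C) (rl : C × List (Tm C) × Tm C) : Prop := TypeLevel S rl.1

/-- The grammar `R ::= α[M⃗] | R N | λx:A.R` used to define arity preservation. -/
inductive APShape (S : Sig C) : Tm C → Prop
  | const {c Ms} : TypeLevel S c → APShape S (Tm.const c Ms)
  | app {R N} : APShape S R → APShape S (Tm.app R N)
  | lam {A R} : APShape S R → APShape S (Tm.lam A R)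

/-- `𝓡` is arity preserving (w.r.t. `Σ`). -/
def ArityPreserving (S : Sig C) (R : Rules C) : Prop :=
  ∀ rl ∈ R, TypeLevelRule S rl → APShape S rl.2.2

/-- `𝓡` is well-formed (w.r.t. `Σ`): right-hand sides of type-level rules are in
the grammar `R ::= α[M⃗] | R N | λx:B.R | Πx:R.R`. -/
def RulesWellFormed (S : Sig C) (R : Rules C) : Prop :=
  ∀ rl ∈ R, TypeLevelRule S rl → PreTypeFam S rl.2.2

/-! ## Simple types and the erasure maps -/

/-- Simple types `σ ::= * | σ → σ`. -/
inductive STy : Type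
  | star : STy
  | arr : STy → STy → STy
deriving DecidableEq

open Classical in
/-- The partial type erasure `⌈·⌉` from Dedukti terms to simple types. -/
noncomputable def tyErase (S : Sig C) : Tm C → Option STy
  | Tm.type => some STy.star
  | Tm.const c _ => if TypeLevel S c then some STy.star else none
  | Tm.pi A B => do return STy.arr (← tyErase S A) (← tyErase S B)
  | Tm.app A _ => tyErase S A
  | Tm.lam _ B => tyErase S B
  | Tm.var _ => none
  | Tm.kind => none

/-- Untyped λ-terms with constants in `K` (the target of the term erasure). -/
inductive LTm (K : Type) : Type
  | var : Nat → LTm K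
  | const : K → LTm K
  | app : LTm K → LTm K → LTm K
  | lam : LTm K → LTm K

namespace LTm
variable {K : Type}

def liftRen' (ρ : Nat → Nat) : Nat → Nat
  | 0 => 0
  | n + 1 => ρ n + 1

def ren (ρ : Nat → Nat) : LTm K → LTm K
  | var n => var (ρ n)
  | const k => const k
  | app M N => app (ren ρ M) (ren ρ N)
  | lam M => lam (ren (liftRen' ρ) M)

/-- Shift free variables `≥ d` up by one. -/
def shiftAbove (d : Nat) : LTm K → LTm K :=
  ren fun n => if n < d then n else n + 1

def liftSub (σ : Nat → LTm K) : Nat → LTm K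
  | 0 => var 0
  | n + 1 => ren Nat.succ (σ n)

def sub (σ : Nat → LTm K) : LTm K → LTm K
  | var n => σ n
  | const k => const k
  | app M N => app (sub σ M) (sub σ N)
  | lam M => lam (sub (liftSub σ) M)

/-- Substitution `M{N/x}` for the variable of index `k`. -/
def substAt (k : Nat) (N : LTm K) : LTm K → LTm K :=
  sub fun n => if n < k then var n else if n = k then ren (· + k) N else var (n - 1)

end LTm

/-- β-reduction for the (simply-typed) λ-calculus. -/
inductive LBeta {K : Type} : LTm K → LTm K → Prop
  | red {M N} : LBeta (LTm.app (LTm.lam M) N) (LTm.substAt 0 N M)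
  | appL {M M' N} : LBeta M M' → LBeta (LTm.app M N) (LTm.app M' N)
  | appR {M N N'} : LBeta N N' → LBeta (LTm.app M N) (LTm.app M N')
  | lam {M M'} : LBeta M M' → LBeta (LTm.lam M) (LTm.lam M')

/-- The partial term erasure `|·|` from Dedukti terms into the λ-calculus with
constants `C ⊕ STy` (`Sum.inr σ` being the constant `π_σ`). -/
noncomputable def erase (S : Sig C) : Tm C → Option (LTm (C ⊕ STy))
  | Tm.var n => some (LTm.var n)
  | Tm.const c Ms => do
      let ts ← Ms.attach.mapM fun x => erase S x.1
      return ts.foldl LTm.app (LTm.const (Sum.inl c))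
  | Tm.app M N => do return LTm.app (← erase S M) (← erase S N)
  | Tm.lam A M => do
      return LTm.app (LTm.lam (LTm.lam (LTm.shiftAbove 1 (← erase S M)))) (← erase S A)
  | Tm.pi A B => do
      return LTm.app (LTm.app (LTm.const (Sum.inr (← tyErase S A))) (← erase S A))
        (LTm.lam (← erase S B))
  | Tm.type => none
  | Tm.kind => none
termination_by t => sizeOf t
decreasing_by
  all_goals simp_wf
  all_goals try omega
  all_goals (have h := List.sizeOf_lt_of_mem x.2; omega)

/-- The type `* → (σ → *) → *` of the constant `π_σ`. -/
def piConstTy (σ : STy) : STy := STy.arr STy.star (STy.arr (STy.arr σ STy.star) STy.star)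

/-- `⌈A₁⌉ → ... → ⌈Aₙ⌉ → ⌈A⌉`, as a relation (defined when all erasures are). -/
inductive EraseTele (S : Sig C) : List (Tm C) → Tm C → STy → Prop
  | nil {A σ} : tyErase S A = some σ → EraseTele S [] A σ
  | cons {B Δ A τ σ} : tyErase S B = some τ → EraseTele S Δ A σ →
      EraseTele S (B :: Δ) A (STy.arr τ σ)

/-- The simply-typed constant context `Γ_π, ⌈Σ'⌉`: it declares `π_σ : * → (σ → *) → *`
for every simple type `σ`, and `c : ⌈A₁⌉ → ... → ⌈Aₙ⌉ → ⌈A⌉` for every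
declaration `c[x₁:A₁,...,xₙ:Aₙ] : A` of `Σ'` (erasures being taken w.r.t. `S`). -/
inductive ConstTy (S : Sig C) (S' : Sig C) : C ⊕ STy → STy → Prop
  | piConst (σ : STy) : ConstTy S S' (Sum.inr σ) (piConstTy σ)
  | const {c Δ A σ} : (c, Δ, A) ∈ S' → EraseTele S Δ A σ → ConstTy S S' (Sum.inl c) σ

/-- Typing in the simply-typed λ-calculus, with constants typed by `cty`. -/
inductive STTyped {K : Type} (cty : K → STy → Prop) : List STy → LTm K → STy → Prop
  | var {Γ n σ} : Γ[n]? = some σ → STTyped cty Γ (LTm.var n) σ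
  | const {Γ k σ} : cty k σ → STTyped cty Γ (LTm.const k) σ
  | app {Γ M N σ τ} : STTyped cty Γ M (STy.arr σ τ) → STTyped cty Γ N σ →
      STTyped cty Γ (LTm.app M N) τ
  | lam {Γ M σ τ} : STTyped cty (σ :: Γ) M τ → STTyped cty Γ (LTm.lam M) (STy.arr σ τ)

/-! ## Explicitly-typed Pure Type Systems (EPTS) -/

/-- EPTS terms (de Bruijn): `x | s | Π_{s₁,s₂}(A,[x]B) | λ_{s₁,s₂}(A,[x]B,[x]M) |
@_{s₁,s₂}(A,[x]B,M,N)`. -/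
inductive ETm (S : Type) : Type
  | var : Nat → ETm S
  | sort : S → ETm S
  | pi : S → S → ETm S → ETm S → ETm S
  | lam : S → S → ETm S → ETm S → ETm S → ETm S
  | app : S → S → ETm S → ETm S → ETm S → ETm S → ETm S

namespace ETm
variable {S : Type}

def ren (ρ : Nat → Nat) : ETm S → ETm S
  | var n => var (ρ n)
  | sort s => sort s
  | pi s₁ s₂ A B => pi s₁ s₂ (ren ρ A) (ren (Tm.liftRen ρ) B)
  | lam s₁ s₂ A B M => lam s₁ s₂ (ren ρ A) (ren (Tm.liftRen ρ) B) (ren (Tm.liftRen ρ) M)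
  | app s₁ s₂ A B M N => app s₁ s₂ (ren ρ A) (ren (Tm.liftRen ρ) B) (ren ρ M) (ren ρ N)

def liftSub (σ : Nat → ETm S) : Nat → ETm S
  | 0 => var 0
  | n + 1 => ren Nat.succ (σ n)

def sub (σ : Nat → ETm S) : ETm S → ETm S
  | var n => σ n
  | sort s => sort s
  | pi s₁ s₂ A B => pi s₁ s₂ (sub σ A) (sub (liftSub σ) B)
  | lam s₁ s₂ A B M => lam s₁ s₂ (sub σ A) (sub (liftSub σ) B) (sub (liftSub σ) M)
  | app s₁ s₂ A B M N => app s₁ s₂ (sub σ A) (sub (liftSub σ) B) (sub σ M) (sub σ N)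

/-- Substitution `M{N/x}` for the variable of de Bruijn index `k`. -/
def substAt (k : Nat) (N : ETm S) : ETm S → ETm S :=
  sub fun n => if n < k then var n else if n = k then ren (· + k) N else var (n - 1)

end ETm

variable {S : Type}

/-- Closure of a root relation under all EPTS term-forming contexts. -/
inductive ECong (r : ETm S → ETm S → Prop) : ETm S → ETm S → Prop
  | base {M N} : r M N → ECong r M N
  | piA {s₁ s₂ A A' B} : ECong r A A' → ECong r (.pi s₁ s₂ A B) (.pi s₁ s₂ A' B)
  | piB {s₁ s₂ A B B'} : ECong r B B' → ECong r (.pi s₁ s₂ A B) (.pi s₁ s₂ A B')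
  | lamA {s₁ s₂ A A' B M} : ECong r A A' → ECong r (.lam s₁ s₂ A B M) (.lam s₁ s₂ A' B M)
  | lamB {s₁ s₂ A B B' M} : ECong r B B' → ECong r (.lam s₁ s₂ A B M) (.lam s₁ s₂ A B' M)
  | lamM {s₁ s₂ A B M M'} : ECong r M M' → ECong r (.lam s₁ s₂ A B M) (.lam s₁ s₂ A B M')
  | appA {s₁ s₂ A A' B M N} : ECong r A A' → ECong r (.app s₁ s₂ A B M N) (.app s₁ s₂ A' B M N)
  | appB {s₁ s₂ A B B' M N} : ECong r B B' → ECong r (.app s₁ s₂ A B M N) (.app s₁ s₂ A B' M N)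
  | appM {s₁ s₂ A B M M' N} : ECong r M M' → ECong r (.app s₁ s₂ A B M N) (.app s₁ s₂ A B M' N)
  | appN {s₁ s₂ A B M N N'} : ECong r N N' → ECong r (.app s₁ s₂ A B M N) (.app s₁ s₂ A B M N')

/-- Root β-reduction of the EPTS (linearized rule, one instance per `(s₁,s₂,s₃) ∈ ℛ`):
`@_{s₁,s₂}(A,[x]B, λ_{s₁,s₂}(A',[x]B',[x]M), N) ↪ M{N/x}`. -/
def EBetaRoot (Rrel : S → S → S → Prop) : ETm S → ETm S → Prop := fun M N =>
  ∃ s₁ s₂ s₃ A B A' B' P Q, Rrel s₁ s₂ s₃ ∧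
    M = ETm.app s₁ s₂ A B (ETm.lam s₁ s₂ A' B' P) Q ∧ N = ETm.substAt 0 Q P

/-- One-step EPTS reduction. -/
def EStep (Rrel : S → S → S → Prop) : ETm S → ETm S → Prop := ECong (EBetaRoot Rrel)

/-- EPTS conversion `≡`. -/
def EConv (Rrel : S → S → S → Prop) : ETm S → ETm S → Prop := Relation.EqvGen (EStep Rrel)

mutual
/-- Well-formed EPTS contexts. -/
inductive EWf (Ar : S → S → Prop) (Rr : S → S → S → Prop) : List (ETm S) → Prop
  | empty : EWf Ar Rr []
  | decl {Γ A s} : ETyped Ar Rr Γ A (ETm.sort s) → EWf Ar Rr (A :: Γ)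

/-- The EPTS typing judgment `Γ ⊢ M : A`. -/
inductive ETyped (Ar : S → S → Prop) (Rr : S → S → S → Prop) : List (ETm S) → ETm S → ETm S → Prop
  | sort {Γ s₁ s₂} : EWf Ar Rr Γ → Ar s₁ s₂ → ETyped Ar Rr Γ (ETm.sort s₁) (ETm.sort s₂)
  | var {Γ n A} : EWf Ar Rr Γ → Γ[n]? = some A →
      ETyped Ar Rr Γ (ETm.var n) (ETm.ren (· + (n + 1)) A)
  | conv {Γ M A B s} : ETyped Ar Rr Γ M A → ETyped Ar Rr Γ B (ETm.sort s) →
      EConv Rr A B → ETyped Ar Rr Γ M B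
  | pi {Γ s₁ s₂ s₃ A B} : Rr s₁ s₂ s₃ → ETyped Ar Rr Γ A (ETm.sort s₁) →
      ETyped Ar Rr (A :: Γ) B (ETm.sort s₂) →
      ETyped Ar Rr Γ (ETm.pi s₁ s₂ A B) (ETm.sort s₃)
  | lam {Γ s₁ s₂ s₃ A B M} : Rr s₁ s₂ s₃ → ETyped Ar Rr Γ A (ETm.sort s₁) →
      ETyped Ar Rr (A :: Γ) B (ETm.sort s₂) → ETyped Ar Rr (A :: Γ) M B →
      ETyped Ar Rr Γ (ETm.lam s₁ s₂ A B M) (ETm.pi s₁ s₂ A B)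
  | app {Γ s₁ s₂ s₃ A B M N} : Rr s₁ s₂ s₃ → ETyped Ar Rr Γ A (ETm.sort s₁) →
      ETyped Ar Rr (A :: Γ) B (ETm.sort s₂) → ETyped Ar Rr Γ N A →
      ETyped Ar Rr Γ M (ETm.pi s₁ s₂ A B) →
      ETyped Ar Rr Γ (ETm.app s₁ s₂ A B M N) (ETm.substAt 0 N B)
end

/-- `𝒜` and `ℛ` are functional relations. -/
def FunctionalSpec (Ar : S → S → Prop) (Rr : S → S → S → Prop) : Prop :=
  (∀ s t t', Ar s t → Ar s t' → t = t') ∧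
  (∀ s₁ s₂ t t', Rr s₁ s₂ t → Rr s₁ s₂ t' → t = t')

/-- `s` is a top-sort. -/
def IsTopSort (Ar : S → S → Prop) (s : S) : Prop := ¬ ∃ s', Ar s s'

/-- `Γ ⊢ A type`: `A` is a sort, or `Γ ⊢ A : s` for some sort `s`. -/
def ETypeJ (Ar : S → S → Prop) (Rr : S → S → S → Prop) (Γ : List (ETm S)) (A : ETm S) : Prop :=
  (∃ s, A = ETm.sort s) ∨ ∃ s, ETyped Ar Rr Γ A (ETm.sort s)

/-! ## (Implicit) Pure Type Systems -/

/-- PTS terms. -/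
inductive PTm (S : Type) : Type
  | var : Nat → PTm S
  | sort : S → PTm S
  | pi : PTm S → PTm S → PTm S
  | lam : PTm S → PTm S → PTm S
  | app : PTm S → PTm S → PTm S

namespace PTm
variable {S : Type}

def ren (ρ : Nat → Nat) : PTm S → PTm S
  | var n => var (ρ n)
  | sort s => sort s
  | pi A B => pi (ren ρ A) (ren (Tm.liftRen ρ) B)
  | lam A M => lam (ren ρ A) (ren (Tm.liftRen ρ) M)
  | app M N => app (ren ρ M) (ren ρ N)

def liftSub (σ : Nat → PTm S) : Nat → PTm S
  | 0 => var 0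
  | n + 1 => ren Nat.succ (σ n)

def sub (σ : Nat → PTm S) : PTm S → PTm S
  | var n => σ n
  | sort s => sort s
  | pi A B => pi (sub σ A) (sub (liftSub σ) B)
  | lam A M => lam (sub σ A) (sub (liftSub σ) M)
  | app M N => app (sub σ M) (sub σ N)

def substAt (k : Nat) (N : PTm S) : PTm S → PTm S :=
  sub fun n => if n < k then var n else if n = k then ren (· + k) N else var (n - 1)

end PTm

/-- One-step β-reduction of PTS terms. -/
inductive PBeta : PTm S → PTm S → Prop
  | red {A M N} : PBeta (PTm.app (PTm.lam A M) N) (PTm.substAt 0 N M)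
  | piA {A A' B} : PBeta A A' → PBeta (PTm.pi A B) (PTm.pi A' B)
  | piB {A B B'} : PBeta B B' → PBeta (PTm.pi A B) (PTm.pi A B')
  | lamA {A A' M} : PBeta A A' → PBeta (PTm.lam A M) (PTm.lam A' M)
  | lamM {A M M'} : PBeta M M' → PBeta (PTm.lam A M) (PTm.lam A M')
  | appL {M M' N} : PBeta M M' → PBeta (PTm.app M N) (PTm.app M' N)
  | appR {M N N'} : PBeta N N' → PBeta (PTm.app M N) (PTm.app M N')

/-- PTS conversion. -/
def PConv : PTm S → PTm S → Prop := Relation.EqvGen PBeta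

mutual
/-- Well-formed PTS contexts. -/
inductive PWf (Ar : S → S → Prop) (Rr : S → S → S → Prop) : List (PTm S) → Prop
  | empty : PWf Ar Rr []
  | decl {Γ A s} : PTyped Ar Rr Γ A (PTm.sort s) → PWf Ar Rr (A :: Γ)

/-- The PTS typing judgment. -/
inductive PTyped (Ar : S → S → Prop) (Rr : S → S → S → Prop) : List (PTm S) → PTm S → PTm S → Prop
  | sort {Γ s₁ s₂} : PWf Ar Rr Γ → Ar s₁ s₂ → PTyped Ar Rr Γ (PTm.sort s₁) (PTm.sort s₂)
  | var {Γ n A} : PWf Ar Rr Γ → Γ[n]? = some A →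
      PTyped Ar Rr Γ (PTm.var n) (PTm.ren (· + (n + 1)) A)
  | conv {Γ M A B s} : PTyped Ar Rr Γ M A → PTyped Ar Rr Γ B (PTm.sort s) →
      PConv A B → PTyped Ar Rr Γ M B
  | pi {Γ s₁ s₂ s₃ A B} : Rr s₁ s₂ s₃ → PTyped Ar Rr Γ A (PTm.sort s₁) →
      PTyped Ar Rr (A :: Γ) B (PTm.sort s₂) →
      PTyped Ar Rr Γ (PTm.pi A B) (PTm.sort s₃)
  | lam {Γ s₁ s₂ s₃ A B M} : Rr s₁ s₂ s₃ → PTyped Ar Rr Γ A (PTm.sort s₁) →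
      PTyped Ar Rr (A :: Γ) B (PTm.sort s₂) → PTyped Ar Rr (A :: Γ) M B →
      PTyped Ar Rr Γ (PTm.lam A M) (PTm.pi A B)
  | app {Γ A B M N} : PTyped Ar Rr Γ M (PTm.pi A B) → PTyped Ar Rr Γ N A →
      PTyped Ar Rr Γ (PTm.app M N) (PTm.substAt 0 N B)
end

/-- `Γ ⊢_PTS A type`. -/
def PTypeJ (Ar : S → S → Prop) (Rr : S → S → S → Prop) (Γ : List (PTm S)) (A : PTm S) : Prop :=
  (∃ s, A = PTm.sort s) ∨ ∃ s, PTyped Ar Rr Γ A (PTm.sort s)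

/-- The natural erasure from EPTS terms to PTS terms. -/
def epsErase : ETm S → PTm S
  | ETm.var n => PTm.var n
  | ETm.sort s => PTm.sort s
  | ETm.pi _ _ A B => PTm.pi (epsErase A) (epsErase B)
  | ETm.lam _ _ A _ M => PTm.lam (epsErase A) (epsErase M)
  | ETm.app _ _ _ _ M N => PTm.app (epsErase M) (epsErase N)

/-! ## The encoding of EPTSs in Dedukti -/

/-- The constants of the theory `(Σ_EPTS, 𝓡_EPTS)`. -/
inductive EConst (S : Type) : Type
  | U : S → EConst S
  | El : S → EConst S
  | u : S → EConst S
  | Prod : S → S → EConst S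
  | abs : S → S → EConst S
  | app : S → S → EConst S

/-- `U_s`. -/
def Ucon (s : S) : Tm (EConst S) := Tm.const (EConst.U s) []
/-- `El_s A`. -/
def Elcon (s : S) (A : Tm (EConst S)) : Tm (EConst S) := Tm.const (EConst.El s) [A]
/-- `u_s`. -/
def ucon (s : S) : Tm (EConst S) := Tm.const (EConst.u s) []
/-- `Prod_{s₁,s₂} A B`. -/
def ProdC (s₁ s₂ : S) (A B : Tm (EConst S)) : Tm (EConst S) :=
  Tm.const (EConst.Prod s₁ s₂) [A, B]
/-- `abs_{s₁,s₂} A B M`. -/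
def absC (s₁ s₂ : S) (A B M : Tm (EConst S)) : Tm (EConst S) :=
  Tm.const (EConst.abs s₁ s₂) [A, B, M]
/-- `app_{s₁,s₂} A B M N`. -/
def appC (s₁ s₂ : S) (A B M N : Tm (EConst S)) : Tm (EConst S) :=
  Tm.const (EConst.app s₁ s₂) [A, B, M, N]

/-- The signature `Σ_EPTS` (telescopes in de Bruijn form). -/
inductive SigEPTSMem (Ar : S → S → Prop) (Rr : S → S → S → Prop) :
    EConst S × List (Tm (EConst S)) × Tm (EConst S) → Prop
  | U (s : S) : SigEPTSMem Ar Rr (EConst.U s, [], Tm.type)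
  | El (s : S) : SigEPTSMem Ar Rr (EConst.El s, [Ucon s], Tm.type)
  | u {s₁ s₂} : Ar s₁ s₂ → SigEPTSMem Ar Rr (EConst.u s₁, [], Ucon s₂)
  | Prod {s₁ s₂ s₃} : Rr s₁ s₂ s₃ →
      SigEPTSMem Ar Rr (EConst.Prod s₁ s₂,
        [Ucon s₁, Tm.pi (Elcon s₁ (Tm.var 0)) (Ucon s₂)],
        Ucon s₃)
  | abs {s₁ s₂ s₃} : Rr s₁ s₂ s₃ →
      SigEPTSMem Ar Rr (EConst.abs s₁ s₂,
        [Ucon s₁, Tm.pi (Elcon s₁ (Tm.var 0)) (Ucon s₂),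
         Tm.pi (Elcon s₁ (Tm.var 1)) (Elcon s₂ (Tm.app (Tm.var 1) (Tm.var 0)))],
        Elcon s₃ (ProdC s₁ s₂ (Tm.var 2) (Tm.var 1)))
  | app {s₁ s₂ s₃} : Rr s₁ s₂ s₃ →
      SigEPTSMem Ar Rr (EConst.app s₁ s₂,
        [Ucon s₁, Tm.pi (Elcon s₁ (Tm.var 0)) (Ucon s₂),
         Elcon s₃ (ProdC s₁ s₂ (Tm.var 1) (Tm.var 0)),
         Elcon s₁ (Tm.var 2)],
        Elcon s₂ (Tm.app (Tm.var 2) (Tm.var 0)))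

/-- `Σ_EPTS` as a signature. -/
def sigEPTS (Ar : S → S → Prop) (Rr : S → S → S → Prop) : Sig (EConst S) :=
  fun e => SigEPTSMem Ar Rr e

/-- The rules `El_{s₂} u_{s₁} ↪ U_{s₁}` for `(s₁,s₂) ∈ 𝒜`. -/
inductive URulesMem (Ar : S → S → Prop) :
    EConst S × List (Tm (EConst S)) × Tm (EConst S) → Prop
  | u_red {s₁ s₂} : Ar s₁ s₂ → URulesMem Ar (EConst.El s₂, [ucon s₁], Ucon s₁)

/-- The rules `app_{s₁,s₂} A B (abs_{s₁,s₂} A' B' M) N ↪ M N` for `(s₁,s₂,s₃) ∈ ℛ`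
(pattern variables `A,B,A',B',M,N` are the de Bruijn variables `0,…,5`). -/
inductive BetaRulesMem (Rr : S → S → S → Prop) :
    EConst S × List (Tm (EConst S)) × Tm (EConst S) → Prop
  | beta {s₁ s₂ s₃} : Rr s₁ s₂ s₃ →
      BetaRulesMem Rr (EConst.app s₁ s₂,
        [Tm.var 0, Tm.var 1, absC s₁ s₂ (Tm.var 2) (Tm.var 3) (Tm.var 4), Tm.var 5],
        Tm.app (Tm.var 4) (Tm.var 5))

/-- The `u_{s₁}`-red rules as a rule set. -/
def uRules (Ar : S → S → Prop) : Rules (EConst S) := fun e => URulesMem Ar e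

/-- The `beta_{s₁,s₂}` rules as a rule set. -/
def betaRules (Rr : S → S → S → Prop) : Rules (EConst S) := fun e => BetaRulesMem Rr e

/-- The rewrite system `𝓡_EPTS`. -/
def rulesEPTS (Ar : S → S → Prop) (Rr : S → S → S → Prop) : Rules (EConst S) :=
  uRules Ar ∪ betaRules Rr

/-- The translation `⟦·⟧` from EPTS terms to Dedukti terms. -/
def trans : ETm S → Tm (EConst S)
  | ETm.var n => Tm.var n
  | ETm.sort s => ucon s
  | ETm.pi s₁ s₂ A B =>
      ProdC s₁ s₂ (trans A) (Tm.lam (Elcon s₁ (trans A)) (trans B))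
  | ETm.lam s₁ s₂ A B M =>
      absC s₁ s₂ (trans A) (Tm.lam (Elcon s₁ (trans A)) (trans B))
        (Tm.lam (Elcon s₁ (trans A)) (trans M))
  | ETm.app s₁ s₂ A B M N =>
      appC s₁ s₂ (trans A) (Tm.lam (Elcon s₁ (trans A)) (trans B)) (trans M) (trans N)

/-- The translation `⟦·⟧` on (well-formed) contexts: `⟦Γ, x:A⟧ = ⟦Γ⟧, x : El_{s_A} ⟦A⟧`
where `Γ ⊢ A : s_A`. -/
inductive TransCtx (Ar : S → S → Prop) (Rr : S → S → S → Prop) :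
    List (ETm S) → List (Tm (EConst S)) → Prop
  | nil : TransCtx Ar Rr [] []
  | cons {Γ Δ A sA} : TransCtx Ar Rr Γ Δ → ETyped Ar Rr Γ A (ETm.sort sA) →
      TransCtx Ar Rr (A :: Γ) (Elcon sA (trans A) :: Δ)

/-- Invertible forms. -/
inductive Invertible : Tm (EConst S) → Prop
  | var {n} : Invertible (Tm.var n)
  | u {s} : Invertible (ucon s)
  | abs {s₁ s₂ A T₁ B T₂ M} : Invertible A → Invertible B → Invertible M →
      Invertible (absC s₁ s₂ A (Tm.lam T₁ B) (Tm.lam T₂ M))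
  | beta {T M N} : Invertible M → Invertible N →
      Invertible (Tm.app (Tm.lam T M) N)
  | prod {s₁ s₂ A T₁ B} : Invertible A → Invertible B →
      Invertible (ProdC s₁ s₂ A (Tm.lam T₁ B))
  | app {s₁ s₂ A T₁ B M N} : Invertible A → Invertible B → Invertible M → Invertible N →
      Invertible (appC s₁ s₂ A (Tm.lam T₁ B) M N)

/-- The inverse translation `|·|`, defined (at least) on invertible forms. -/
def inv : Tm (EConst S) → Option (ETm S)
  | Tm.var n => some (ETm.var n)
  | Tm.const (EConst.u s) [] => some (ETm.sort s)
  | Tm.app (Tm.lam _ M) N => do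
      return ETm.substAt 0 (← inv N) (← inv M)
  | Tm.const (EConst.Prod s₁ s₂) [A, Tm.lam _ B] => do
      return ETm.pi s₁ s₂ (← inv A) (← inv B)
  | Tm.const (EConst.abs s₁ s₂) [A, Tm.lam _ B, Tm.lam _ M] => do
      return ETm.lam s₁ s₂ (← inv A) (← inv B) (← inv M)
  | Tm.const (EConst.app s₁ s₂) [A, Tm.lam _ B, M, N] => do
      return ETm.app s₁ s₂ (← inv A) (← inv B) (← inv M) (← inv N)
  | _ => none
termination_by t => sizeOf t
decreasing_by
  all_goals simp_wf
  all_goals omega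

/-- Hidden rewriting steps: a `↪_{β𝓡}` step inside the type annotation of a binder. -/
def HStep (R : Rules (EConst S)) : Tm (EConst S) → Tm (EConst S) → Prop :=
  Cong fun M N => ∃ A A' P, Step R A A' ∧ M = Tm.lam A P ∧ N = Tm.lam A' P

/-- The hidden conversion `≡_H`. -/
def HConv (R : Rules (EConst S)) : Tm (EConst S) → Tm (EConst S) → Prop :=
  Relation.EqvGen (HStep R)


/-- The relation `≡_I` (`M ≡_I N` iff `|M| = |N|` and `M ≡ N`) is an equivalence on
well-typed EPTS terms. -/
theorem equivI_equivalence {S : Type} (Ar : S → S → Prop) (Rr : S → S → S → Prop)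
    (Γ' : List (ETm S)) (A' : ETm S) :
    Equivalence (fun (x y : {M : ETm S // ETyped Ar Rr Γ' M A'}) =>
      epsErase x.1 = epsErase y.1 ∧ EConv Rr x.1 y.1) :=
  ⟨fun _ => ⟨rfl, Relation.EqvGen.refl _⟩,
   fun h => ⟨h.1.symm, Relation.EqvGen.symm _ _ h.2⟩,
   fun h h' => ⟨h.1.trans h'.1, Relation.EqvGen.trans _ _ _ h.2 h'.2⟩⟩

/-! ## Renaming and substitution in EPTS terms -/

namespace ETm

theorem ren_eq_sub (M : ETm S) : ∀ ρ : Nat → Nat, ren ρ M = sub (fun n => var (ρ n)) M := by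
  have lift : ∀ ρ : Nat → Nat,
      liftSub (S := S) (fun n => var (ρ n)) = fun n => var (Tm.liftRen ρ n) := by
    intro ρ; funext n; cases n <;> rfl
  induction M <;> intro ρ <;> simp_all [ren, sub]

theorem sub_ren (M : ETm S) :
    ∀ (σ : Nat → ETm S) (ρ : Nat → Nat), sub σ (ren ρ M) = sub (fun n => σ (ρ n)) M := by
  have lift : ∀ (σ : Nat → ETm S) (ρ : Nat → Nat),
      (fun n => liftSub σ (Tm.liftRen ρ n)) = liftSub fun n => σ (ρ n) := by
    intro σ ρ; funext n; cases n <;> rfl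
  induction M <;> intro σ ρ <;> simp_all [ren, sub]

theorem ren_ren (M : ETm S) (ρ τ : Nat → Nat) : ren ρ (ren τ M) = ren (fun n => ρ (τ n)) M := by
  rw [ren_eq_sub _ ρ, sub_ren, ren_eq_sub]

theorem ren_liftRen_ren_succ (M : ETm S) (ρ : Nat → Nat) :
    ren (Tm.liftRen ρ) (ren Nat.succ M) = ren Nat.succ (ren ρ M) := by
  rw [ren_ren, ren_ren]; rfl

theorem ren_sub (M : ETm S) :
    ∀ (ρ : Nat → Nat) (σ : Nat → ETm S), ren ρ (sub σ M) = sub (fun n => ren ρ (σ n)) M := by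
  have lift : ∀ (ρ : Nat → Nat) (σ : Nat → ETm S),
      (fun n => ren (Tm.liftRen ρ) (liftSub σ n)) = liftSub fun n => ren ρ (σ n) := by
    intro ρ σ; funext n
    cases n with
    | zero => rfl
    | succ n => exact ren_liftRen_ren_succ _ _
  induction M <;> intro ρ σ <;> simp_all [ren, sub]

theorem sub_liftSub_ren_succ (M : ETm S) (σ : Nat → ETm S) :
    sub (liftSub σ) (ren Nat.succ M) = ren Nat.succ (sub σ M) := by
  rw [sub_ren, ren_sub]; rfl

theorem sub_sub (M : ETm S) :
    ∀ τ σ : Nat → ETm S, sub τ (sub σ M) = sub (fun n => sub τ (σ n)) M := by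
  have lift : ∀ τ σ : Nat → ETm S,
      (fun n => sub (liftSub τ) (liftSub σ n)) = liftSub fun n => sub τ (σ n) := by
    intro τ σ; funext n
    cases n with
    | zero => rfl
    | succ n => exact sub_liftSub_ren_succ _ _
  induction M <;> intro τ σ <;> simp_all [sub]

theorem liftSub_var : liftSub (S := S) var = var := by
  funext n; cases n <;> rfl

theorem sub_var (M : ETm S) : sub var M = M := by
  induction M <;> simp_all [sub, liftSub_var]

theorem ren_id (M : ETm S) : ren (fun n => n) M = M := by
  rw [ren_eq_sub]; exact sub_var M

/-- The substitution replacing the variable `0` by `N` and lowering the others. -/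
def inst (N : ETm S) : Nat → ETm S
  | 0 => N
  | n + 1 => var n

theorem substAt_zero (N M : ETm S) : substAt 0 N M = sub (inst N) M := by
  unfold substAt
  congr 1
  funext n
  cases n with
  | zero => exact ren_id N
  | succ n => simp [inst]

theorem sub_inst_ren_succ (N M : ETm S) : sub (inst N) (ren Nat.succ M) = M := by
  rw [sub_ren]; exact sub_var M

theorem sub_substAt (σ : Nat → ETm S) (N M : ETm S) :
    sub σ (substAt 0 N M) = substAt 0 (sub σ N) (sub (liftSub σ) M) := by
  simp only [substAt_zero, sub_sub]
  congr 1
  funext n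
  cases n with
  | zero => rfl
  | succ n => exact (sub_inst_ren_succ _ _).symm

theorem ren_substAt (ρ : Nat → Nat) (N M : ETm S) :
    ren ρ (substAt 0 N M) = substAt 0 (ren ρ N) (ren (Tm.liftRen ρ) M) := by
  simp only [substAt_zero, ren_sub, sub_ren]
  congr 1
  funext n
  cases n <;> rfl

end ETm

/-! ## Confluence of EPTS reduction -/

variable {Ar : S → S → Prop} {Rr : S → S → S → Prop}

/-- Parallel reduction of EPTS terms. -/
inductive EPar (Rr : S → S → S → Prop) : ETm S → ETm S → Prop
  | var {n} : EPar Rr (.var n) (.var n)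
  | sort {s} : EPar Rr (.sort s) (.sort s)
  | pi {s₁ s₂ A A' B B'} : EPar Rr A A' → EPar Rr B B' →
      EPar Rr (.pi s₁ s₂ A B) (.pi s₁ s₂ A' B')
  | lam {s₁ s₂ A A' B B' M M'} : EPar Rr A A' → EPar Rr B B' → EPar Rr M M' →
      EPar Rr (.lam s₁ s₂ A B M) (.lam s₁ s₂ A' B' M')
  | app {s₁ s₂ A A' B B' M M' N N'} : EPar Rr A A' → EPar Rr B B' → EPar Rr M M' →
      EPar Rr N N' → EPar Rr (.app s₁ s₂ A B M N) (.app s₁ s₂ A' B' M' N')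
  | beta {s₁ s₂ s₃ A B A' B' M M' N N'} : Rr s₁ s₂ s₃ → EPar Rr M M' → EPar Rr N N' →
      EPar Rr (.app s₁ s₂ A B (.lam s₁ s₂ A' B' M) N) (ETm.substAt 0 N' M')

namespace EPar

theorem refl (M : ETm S) : EPar Rr M M := by
  induction M with
  | var => exact .var
  | sort => exact .sort
  | pi _ _ _ _ hA hB => exact .pi hA hB
  | lam _ _ _ _ _ hA hB hM => exact .lam hA hB hM
  | app _ _ _ _ _ _ hA hB hM hN => exact .app hA hB hM hN

theorem ren {M M' : ETm S} (h : EPar Rr M M') :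
    ∀ ρ, EPar Rr (ETm.ren ρ M) (ETm.ren ρ M') := by
  induction h with
  | var | sort => exact fun _ => refl _
  | pi _ _ hA hB => exact fun _ => .pi (hA _) (hB _)
  | lam _ _ _ hA hB hM => exact fun _ => .lam (hA _) (hB _) (hM _)
  | app _ _ _ _ hA hB hM hN => exact fun _ => .app (hA _) (hB _) (hM _) (hN _)
  | beta hR _ _ hM hN =>
    intro ρ
    rw [ETm.ren_substAt]
    exact .beta hR (hM _) (hN _)

theorem liftSub {σ σ' : Nat → ETm S} (h : ∀ n, EPar Rr (σ n) (σ' n)) :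
    ∀ n, EPar Rr (ETm.liftSub σ n) (ETm.liftSub σ' n)
  | 0 => .var
  | n + 1 => (h n).ren _

theorem sub {M M' : ETm S} (h : EPar Rr M M') :
    ∀ {σ σ' : Nat → ETm S}, (∀ n, EPar Rr (σ n) (σ' n)) →
      EPar Rr (ETm.sub σ M) (ETm.sub σ' M') := by
  induction h with
  | var => exact fun hσ => hσ _
  | sort => exact fun _ => .sort
  | pi _ _ hA hB => exact fun hσ => .pi (hA hσ) (hB (liftSub hσ))
  | lam _ _ _ hA hB hM => exact fun hσ => .lam (hA hσ) (hB (liftSub hσ)) (hM (liftSub hσ))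
  | app _ _ _ _ hA hB hM hN =>
    exact fun hσ => .app (hA hσ) (hB (liftSub hσ)) (hM hσ) (hN hσ)
  | beta hR _ _ hM hN =>
    intro σ σ' hσ
    rw [ETm.sub_substAt]
    exact .beta hR (hM (liftSub hσ)) (hN hσ)

theorem substAt {M M' N N' : ETm S} (hM : EPar Rr M M') (hN : EPar Rr N N') :
    EPar Rr (ETm.substAt 0 N M) (ETm.substAt 0 N' M') := by
  rw [ETm.substAt_zero, ETm.substAt_zero]
  refine hM.sub fun n => ?_
  cases n with
  | zero => exact hN
  | succ n => exact .var

theorem diamond {M P Q : ETm S} (h : EPar Rr M P) (h' : EPar Rr M Q) :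
    ∃ R, EPar Rr P R ∧ EPar Rr Q R := by
  induction h generalizing Q with
  | var | sort => exact ⟨Q, h', refl _⟩
  | pi _ _ ihA ihB =>
    cases h' with
    | pi hA hB =>
      obtain ⟨A, hA₁, hA₂⟩ := ihA hA
      obtain ⟨B, hB₁, hB₂⟩ := ihB hB
      exact ⟨_, .pi hA₁ hB₁, .pi hA₂ hB₂⟩
  | lam _ _ _ ihA ihB ihM =>
    cases h' with
    | lam hA hB hM =>
      obtain ⟨A, hA₁, hA₂⟩ := ihA hA
      obtain ⟨B, hB₁, hB₂⟩ := ihB hB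
      obtain ⟨M, hM₁, hM₂⟩ := ihM hM
      exact ⟨_, .lam hA₁ hB₁ hM₁, .lam hA₂ hB₂ hM₂⟩
  | app _ _ hM' _ ihA ihB ihM ihN =>
    cases h' with
    | app hA hB hM hN =>
      obtain ⟨A, hA₁, hA₂⟩ := ihA hA
      obtain ⟨B, hB₁, hB₂⟩ := ihB hB
      obtain ⟨M, hM₁, hM₂⟩ := ihM hM
      obtain ⟨N, hN₁, hN₂⟩ := ihN hN
      exact ⟨_, .app hA₁ hB₁ hM₁ hN₁, .app hA₂ hB₂ hM₂ hN₂⟩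
    | beta hR hM hN =>
      obtain ⟨N, hN₁, hN₂⟩ := ihN hN
      cases hM' with
      | lam _ _ _ =>
        obtain ⟨L, hL₁, hL₂⟩ := ihM (.lam (refl _) (refl _) hM)
        cases hL₁ with
        | lam _ _ hM₁ =>
          cases hL₂ with
          | lam _ _ hM₂ => exact ⟨_, .beta hR hM₁ hN₁, hM₂.substAt hN₂⟩
  | beta hR _ _ ihM ihN =>
    cases h' with
    | app hA hB hL hN =>
      cases hL with
      | lam _ _ hM =>
        obtain ⟨M, hM₁, hM₂⟩ := ihM hM
        obtain ⟨N, hN₁, hN₂⟩ := ihN hN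
        exact ⟨_, hM₁.substAt hN₁, .beta hR hM₂ hN₂⟩
    | beta _ hM hN =>
      obtain ⟨M, hM₁, hM₂⟩ := ihM hM
      obtain ⟨N, hN₁, hN₂⟩ := ihN hN
      exact ⟨_, hM₁.substAt hN₁, hM₂.substAt hN₂⟩

end EPar

/-- Many-step EPTS reduction. -/
abbrev ESteps (Rr : S → S → S → Prop) : ETm S → ETm S → Prop := Relation.ReflTransGen (EStep Rr)

theorem EStep.ePar {M N : ETm S} (h : EStep Rr M N) : EPar Rr M N := by
  unfold EStep at h
  induction h with
  | base h =>
    obtain ⟨s₁, s₂, s₃, A, B, A', B', P, Q, hR, rfl, rfl⟩ := h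
    exact .beta hR (.refl _) (.refl _)
  | piA _ h => exact .pi h (.refl _)
  | piB _ h => exact .pi (.refl _) h
  | lamA _ h => exact .lam h (.refl _) (.refl _)
  | lamB _ h => exact .lam (.refl _) h (.refl _)
  | lamM _ h => exact .lam (.refl _) (.refl _) h
  | appA _ h => exact .app h (.refl _) (.refl _) (.refl _)
  | appB _ h => exact .app (.refl _) h (.refl _) (.refl _)
  | appM _ h => exact .app (.refl _) (.refl _) h (.refl _)
  | appN _ h => exact .app (.refl _) (.refl _) (.refl _) h

namespace ESteps

theorem pi {s₁ s₂ : S} {A A' B B' : ETm S} (hA : ESteps Rr A A') (hB : ESteps Rr B B') :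
    ESteps Rr (.pi s₁ s₂ A B) (.pi s₁ s₂ A' B') :=
  (hA.lift (ETm.pi s₁ s₂ · B) fun _ _ => .piA).trans
    (hB.lift (ETm.pi s₁ s₂ A' ·) fun _ _ => .piB)

theorem lam {s₁ s₂ : S} {A A' B B' M M' : ETm S} (hA : ESteps Rr A A') (hB : ESteps Rr B B')
    (hM : ESteps Rr M M') : ESteps Rr (.lam s₁ s₂ A B M) (.lam s₁ s₂ A' B' M') :=
  ((hA.lift (ETm.lam s₁ s₂ · B M) fun _ _ => .lamA).trans
    (hB.lift (ETm.lam s₁ s₂ A' · M) fun _ _ => .lamB)).trans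
    (hM.lift (ETm.lam s₁ s₂ A' B' ·) fun _ _ => .lamM)

theorem app {s₁ s₂ : S} {A A' B B' M M' N N' : ETm S} (hA : ESteps Rr A A')
    (hB : ESteps Rr B B') (hM : ESteps Rr M M') (hN : ESteps Rr N N') :
    ESteps Rr (.app s₁ s₂ A B M N) (.app s₁ s₂ A' B' M' N') :=
  (((hA.lift (ETm.app s₁ s₂ · B M N) fun _ _ => .appA).trans
    (hB.lift (ETm.app s₁ s₂ A' · M N) fun _ _ => .appB)).trans
    (hM.lift (ETm.app s₁ s₂ A' B' · N) fun _ _ => .appM)).trans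
    (hN.lift (ETm.app s₁ s₂ A' B' M' ·) fun _ _ => .appN)

theorem eConv {M N : ETm S} (h : ESteps Rr M N) : EConv Rr M N := by
  induction h with
  | refl => exact Relation.EqvGen.refl _
  | tail _ h ih => exact Relation.EqvGen.trans _ _ _ ih (Relation.EqvGen.rel _ _ h)

theorem sort_eq {s : S} {M : ETm S} (h : ESteps Rr (.sort s) M) : M = .sort s := by
  induction h with
  | refl => rfl
  | tail _ h ih =>
    subst ih
    cases h.ePar
    rfl

theorem pi_inv {s₁ s₂ : S} {A B M : ETm S} (h : ESteps Rr (.pi s₁ s₂ A B) M) :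
    ∃ A' B', M = .pi s₁ s₂ A' B' ∧ ESteps Rr A A' ∧ ESteps Rr B B' := by
  induction h with
  | refl => exact ⟨A, B, rfl, .refl, .refl⟩
  | tail _ h ih =>
    obtain ⟨A', B', rfl, hA, hB⟩ := ih
    cases h with
    | base h => obtain ⟨_, _, _, _, _, _, _, _, _, _, h, _⟩ := h; cases h
    | piA h => exact ⟨_, _, rfl, hA.tail h, hB⟩
    | piB h => exact ⟨_, _, rfl, hA, hB.tail h⟩

end ESteps

theorem EPar.eSteps {M N : ETm S} (h : EPar Rr M N) : ESteps Rr M N := by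
  induction h with
  | var | sort => exact .refl
  | pi _ _ hA hB => exact .pi hA hB
  | lam _ _ _ hA hB hM => exact .lam hA hB hM
  | app _ _ _ _ hA hB hM hN => exact .app hA hB hM hN
  | beta hR _ _ hM hN =>
    exact (ESteps.app .refl .refl (.lam .refl .refl hM) hN).tail
      (.base ⟨_, _, _, _, _, _, _, _, _, hR, rfl, rfl⟩)

namespace EConv

theorem refl (M : ETm S) : EConv Rr M M := Relation.EqvGen.refl M

theorem symm {M N : ETm S} (h : EConv Rr M N) : EConv Rr N M := Relation.EqvGen.symm _ _ h

theorem trans {M N P : ETm S} (hMN : EConv Rr M N) (hNP : EConv Rr N P) :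
    EConv Rr M P :=
  Relation.EqvGen.trans _ _ _ hMN hNP

/-- The Church–Rosser property. -/
theorem join {M N : ETm S} (h : EConv Rr M N) : ∃ P, ESteps Rr M P ∧ ESteps Rr N P := by
  have toSteps : ∀ {a b : ETm S}, Relation.ReflTransGen (EPar Rr) a b → ESteps Rr a b := by
    intro a b hab
    induction hab with
    | refl => exact .refl
    | tail _ h ih => exact ih.trans h.eSteps
  have equiv : Equivalence (Relation.Join (Relation.ReflTransGen (EPar Rr))) :=
    Relation.equivalence_join_reflTransGen fun a b c hab hac =>
      let ⟨d, hbd, hcd⟩ := hab.diamond hac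
      ⟨d, .single hbd, .single hcd⟩
  have key : Relation.Join (Relation.ReflTransGen (EPar Rr)) M N := by
    unfold EConv at h
    induction h with
    | rel _ _ h => exact ⟨_, .single h.ePar, .refl⟩
    | refl _ => exact equiv.refl _
    | symm _ _ _ ih => exact equiv.symm ih
    | trans _ _ _ _ _ ih ih' => exact equiv.trans ih ih'
  obtain ⟨P, hM, hN⟩ := key
  exact ⟨P, toSteps hM, toSteps hN⟩

theorem map {f : ETm S → ETm S} (hf : ∀ {M N}, EStep Rr M N → EConv Rr (f M) (f N))
    {M N : ETm S} (h : EConv Rr M N) : EConv Rr (f M) (f N) := by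
  unfold EConv at h
  induction h with
  | rel _ _ h => exact hf h
  | refl _ => exact refl _
  | symm _ _ _ ih => exact ih.symm
  | trans _ _ _ _ _ ih ih' => exact ih.trans ih'

theorem sub {M N : ETm S} (h : EConv Rr M N) (σ : Nat → ETm S) :
    EConv Rr (ETm.sub σ M) (ETm.sub σ N) :=
  h.map fun h => (h.ePar.sub fun n => .refl (σ n)).eSteps.eConv

theorem ren {M N : ETm S} (h : EConv Rr M N) (ρ : Nat → Nat) :
    EConv Rr (ETm.ren ρ M) (ETm.ren ρ N) := by
  rw [ETm.ren_eq_sub, ETm.ren_eq_sub]; exact h.sub _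

theorem substAt_left {M N : ETm S} (h : EConv Rr M N) (Q : ETm S) :
    EConv Rr (ETm.substAt 0 Q M) (ETm.substAt 0 Q N) := h.sub _

theorem of_step {M N : ETm S} (h : EStep Rr M N) : EConv Rr M N := Relation.EqvGen.rel _ _ h

theorem pi {s₁ s₂ : S} {A A' B B' : ETm S} (hA : EConv Rr A A') (hB : EConv Rr B B') :
    EConv Rr (.pi s₁ s₂ A B) (.pi s₁ s₂ A' B') :=
  (hA.map (f := (ETm.pi s₁ s₂ · B)) fun h => of_step (.piA h)).trans
    (hB.map (f := (ETm.pi s₁ s₂ A' ·)) fun h => of_step (.piB h))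

theorem lam {s₁ s₂ : S} {A A' B B' M M' : ETm S} (hA : EConv Rr A A') (hB : EConv Rr B B')
    (hM : EConv Rr M M') : EConv Rr (.lam s₁ s₂ A B M) (.lam s₁ s₂ A' B' M') :=
  ((hA.map (f := (ETm.lam s₁ s₂ · B M)) fun h => of_step (.lamA h)).trans
    (hB.map (f := (ETm.lam s₁ s₂ A' · M)) fun h => of_step (.lamB h))).trans
    (hM.map (f := (ETm.lam s₁ s₂ A' B' ·)) fun h => of_step (.lamM h))

theorem app {s₁ s₂ : S} {A A' B B' M M' N N' : ETm S} (hA : EConv Rr A A')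
    (hB : EConv Rr B B') (hM : EConv Rr M M') (hN : EConv Rr N N') :
    EConv Rr (.app s₁ s₂ A B M N) (.app s₁ s₂ A' B' M' N') :=
  (((hA.map (f := (ETm.app s₁ s₂ · B M N)) fun h => of_step (.appA h)).trans
    (hB.map (f := (ETm.app s₁ s₂ A' · M N)) fun h => of_step (.appB h))).trans
    (hM.map (f := (ETm.app s₁ s₂ A' B' · N)) fun h => of_step (.appM h))).trans
    (hN.map (f := (ETm.app s₁ s₂ A' B' M' ·)) fun h => of_step (.appN h))

theorem sort_inj {s t : S} (h : EConv Rr (.sort s) (.sort t)) : s = t := by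
  obtain ⟨P, hs, ht⟩ := h.join
  have := hs.sort_eq.symm.trans ht.sort_eq
  cases this
  rfl

theorem pi_inj {s₁ s₂ t₁ t₂ : S} {A A' B B' : ETm S}
    (h : EConv Rr (.pi s₁ s₂ A B) (.pi t₁ t₂ A' B')) :
    s₁ = t₁ ∧ s₂ = t₂ ∧ EConv Rr A A' ∧ EConv Rr B B' := by
  obtain ⟨P, h₁, h₂⟩ := h.join
  obtain ⟨A₁, B₁, rfl, hA₁, hB₁⟩ := h₁.pi_inv
  obtain ⟨A₂, B₂, e, hA₂, hB₂⟩ := h₂.pi_inv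
  cases e
  exact ⟨rfl, rfl, hA₁.eConv.trans hA₂.eConv.symm, hB₁.eConv.trans hB₂.eConv.symm⟩

end EConv

/-! ## Metatheory of EPTS typing -/

namespace ETyped

/-- Induction on EPTS typing derivations, ignoring the derivations of context well-formedness. -/
@[elab_as_elim]
theorem ind {motive : ∀ Γ M A, ETyped Ar Rr Γ M A → Prop}
    (sort : ∀ {Γ s₁ s₂} (hΓ : EWf Ar Rr Γ) (hs : Ar s₁ s₂),
      motive Γ (.sort s₁) (.sort s₂) (.sort hΓ hs))
    (var : ∀ {Γ n A} (hΓ : EWf Ar Rr Γ) (hn : Γ[n]? = some A),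
      motive Γ (.var n) (ETm.ren (· + (n + 1)) A) (.var hΓ hn))
    (conv : ∀ {Γ M A B s} (hM : ETyped Ar Rr Γ M A) (hB : ETyped Ar Rr Γ B (.sort s))
      (hc : EConv Rr A B), motive Γ M A hM → motive Γ B (.sort s) hB →
      motive Γ M B (.conv hM hB hc))
    (pi : ∀ {Γ s₁ s₂ s₃ A B} (hR : Rr s₁ s₂ s₃) (hA : ETyped Ar Rr Γ A (.sort s₁))
      (hB : ETyped Ar Rr (A :: Γ) B (.sort s₂)), motive Γ A (.sort s₁) hA →
      motive (A :: Γ) B (.sort s₂) hB → motive Γ (.pi s₁ s₂ A B) (.sort s₃) (.pi hR hA hB))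
    (lam : ∀ {Γ s₁ s₂ s₃ A B M} (hR : Rr s₁ s₂ s₃) (hA : ETyped Ar Rr Γ A (.sort s₁))
      (hB : ETyped Ar Rr (A :: Γ) B (.sort s₂)) (hM : ETyped Ar Rr (A :: Γ) M B),
      motive Γ A (.sort s₁) hA → motive (A :: Γ) B (.sort s₂) hB → motive (A :: Γ) M B hM →
      motive Γ (.lam s₁ s₂ A B M) (.pi s₁ s₂ A B) (.lam hR hA hB hM))
    (app : ∀ {Γ s₁ s₂ s₃ A B M N} (hR : Rr s₁ s₂ s₃) (hA : ETyped Ar Rr Γ A (.sort s₁))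
      (hB : ETyped Ar Rr (A :: Γ) B (.sort s₂)) (hN : ETyped Ar Rr Γ N A)
      (hM : ETyped Ar Rr Γ M (.pi s₁ s₂ A B)),
      motive Γ A (.sort s₁) hA → motive (A :: Γ) B (.sort s₂) hB → motive Γ N A hN →
      motive Γ M (.pi s₁ s₂ A B) hM →
      motive Γ (.app s₁ s₂ A B M N) (ETm.substAt 0 N B) (.app hR hA hB hN hM))
    {Γ M A} (h : ETyped Ar Rr Γ M A) : motive Γ M A h :=
  ETyped.rec (motive_1 := fun _ _ => True) (motive_2 := motive)
    trivial (fun _ _ => trivial) (fun hw hA _ => sort hw hA) (fun hw h _ => var hw h)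
    conv pi lam app h

theorem wf {Γ : List (ETm S)} {M A : ETm S} (h : ETyped Ar Rr Γ M A) : EWf Ar Rr Γ := by
  induction h using ind with
  | sort h | var h => exact h
  | conv _ _ _ h => exact h
  | pi _ _ _ h => exact h
  | lam _ _ _ _ h => exact h
  | app _ _ _ _ _ h => exact h

theorem ren {Γ : List (ETm S)} {M A : ETm S} (h : ETyped Ar Rr Γ M A) :
    ∀ {Δ : List (ETm S)} {ρ : Nat → Nat}, EWf Ar Rr Δ →
      (∀ n A, Γ[n]? = some A → ∃ A', Δ[ρ n]? = some A' ∧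
        ETm.ren (· + (ρ n + 1)) A' = ETm.ren ρ (ETm.ren (· + (n + 1)) A)) →
      ETyped Ar Rr Δ (ETm.ren ρ M) (ETm.ren ρ A) := by
  have lift : ∀ {Γ Δ : List (ETm S)} {ρ : Nat → Nat} (B : ETm S),
      (∀ n A, Γ[n]? = some A → ∃ A', Δ[ρ n]? = some A' ∧
        ETm.ren (· + (ρ n + 1)) A' = ETm.ren ρ (ETm.ren (· + (n + 1)) A)) →
      ∀ n A, (B :: Γ)[n]? = some A → ∃ A', (ETm.ren ρ B :: Δ)[Tm.liftRen ρ n]? = some A' ∧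
        ETm.ren (· + (Tm.liftRen ρ n + 1)) A' =
          ETm.ren (Tm.liftRen ρ) (ETm.ren (· + (n + 1)) A) := by
    intro Γ Δ ρ B hρ n A hn
    cases n with
    | zero =>
      cases hn
      exact ⟨_, rfl, (ETm.ren_liftRen_ren_succ _ _).symm⟩
    | succ n =>
      obtain ⟨A', hA', e⟩ := hρ n A hn
      refine ⟨A', hA', ?_⟩
      have e' := congrArg (ETm.ren Nat.succ) e
      simp only [ETm.ren_ren] at e' ⊢
      exact e'
  induction h using ind with
  | sort _ hA => exact fun hΔ _ => .sort hΔ hA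
  | var _ hn =>
    intro Δ ρ hΔ hρ
    obtain ⟨A', hA', e⟩ := hρ _ _ hn
    exact e ▸ .var hΔ hA'
  | conv _ _ hc ihM ihB => exact fun hΔ hρ => .conv (ihM hΔ hρ) (ihB hΔ hρ) (hc.ren _)
  | pi hR _ _ ihA ihB =>
    exact fun hΔ hρ => .pi hR (ihA hΔ hρ) (ihB (.decl (ihA hΔ hρ)) (lift _ hρ))
  | lam hR _ _ _ ihA ihB ihM =>
    exact fun hΔ hρ => .lam hR (ihA hΔ hρ) (ihB (.decl (ihA hΔ hρ)) (lift _ hρ))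
      (ihM (.decl (ihA hΔ hρ)) (lift _ hρ))
  | app hR _ _ _ _ ihA ihB ihN ihM =>
    intro Δ ρ hΔ hρ
    rw [ETm.ren_substAt]
    exact .app hR (ihA hΔ hρ) (ihB (.decl (ihA hΔ hρ)) (lift _ hρ)) (ihN hΔ hρ) (ihM hΔ hρ)

theorem weaken {Γ : List (ETm S)} {M A B : ETm S} (h : ETyped Ar Rr Γ M A)
    (hΓ : EWf Ar Rr (B :: Γ)) :
    ETyped Ar Rr (B :: Γ) (ETm.ren Nat.succ M) (ETm.ren Nat.succ A) :=
  h.ren hΓ fun _ A hn => ⟨A, hn, (ETm.ren_ren _ _ _).symm⟩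

theorem sub {Γ : List (ETm S)} {M A : ETm S} (h : ETyped Ar Rr Γ M A) :
    ∀ {Δ : List (ETm S)} {σ : Nat → ETm S}, EWf Ar Rr Δ →
      (∀ n A, Γ[n]? = some A →
        ETyped Ar Rr Δ (σ n) (ETm.sub σ (ETm.ren (· + (n + 1)) A))) →
      ETyped Ar Rr Δ (ETm.sub σ M) (ETm.sub σ A) := by
  have lift : ∀ {Γ Δ : List (ETm S)} {σ : Nat → ETm S} (B : ETm S),
      EWf Ar Rr (ETm.sub σ B :: Δ) →
      (∀ n A, Γ[n]? = some A →
        ETyped Ar Rr Δ (σ n) (ETm.sub σ (ETm.ren (· + (n + 1)) A))) →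
      ∀ n A, (B :: Γ)[n]? = some A → ETyped Ar Rr (ETm.sub σ B :: Δ) (ETm.liftSub σ n)
        (ETm.sub (ETm.liftSub σ) (ETm.ren (· + (n + 1)) A)) := by
    intro Γ Δ σ B hΔ hσ n A hn
    cases n with
    | zero =>
      cases hn
      have h := ETyped.var (n := 0) hΔ rfl
      rwa [show ETm.ren (· + (0 + 1)) (ETm.sub σ B) =
        ETm.sub (ETm.liftSub σ) (ETm.ren (· + (0 + 1)) B) from
        (ETm.sub_liftSub_ren_succ _ _).symm] at h
    | succ n =>
      have h := (hσ n A hn).weaken hΔ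
      rw [← ETm.sub_liftSub_ren_succ, ETm.ren_ren] at h
      exact h
  induction h using ind with
  | sort _ hA => exact fun hΔ _ => .sort hΔ hA
  | var _ hn => exact fun _ hσ => hσ _ _ hn
  | conv _ _ hc ihM ihB => exact fun hΔ hσ => .conv (ihM hΔ hσ) (ihB hΔ hσ) (hc.sub _)
  | pi hR _ _ ihA ihB =>
    intro Δ σ hΔ hσ
    have hA := ihA hΔ hσ
    exact .pi hR hA (ihB (.decl hA) (lift _ (.decl hA) hσ))
  | lam hR _ _ _ ihA ihB ihM =>
    intro Δ σ hΔ hσ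
    have hA := ihA hΔ hσ
    exact .lam hR hA (ihB (.decl hA) (lift _ (.decl hA) hσ))
      (ihM (.decl hA) (lift _ (.decl hA) hσ))
  | app hR _ _ _ _ ihA ihB ihN ihM =>
    intro Δ σ hΔ hσ
    have hA := ihA hΔ hσ
    rw [ETm.sub_substAt]
    exact .app hR hA (ihB (.decl hA) (lift _ (.decl hA) hσ)) (ihN hΔ hσ) (ihM hΔ hσ)

theorem substAt {Γ : List (ETm S)} {M N A B : ETm S} (hM : ETyped Ar Rr (A :: Γ) M B)
    (hN : ETyped Ar Rr Γ N A) :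
    ETyped Ar Rr Γ (ETm.substAt 0 N M) (ETm.substAt 0 N B) := by
  rw [ETm.substAt_zero, ETm.substAt_zero]
  refine hM.sub hN.wf fun n C hn => ?_
  cases n with
  | zero =>
    cases hn
    rwa [show ETm.sub (ETm.inst N) (ETm.ren (· + (0 + 1)) A) = A from ETm.sub_inst_ren_succ _ _]
  | succ n =>
    have h := ETyped.var hN.wf hn
    rwa [← ETm.sub_inst_ren_succ N (ETm.ren (· + (n + 1)) C), ETm.ren_ren] at h

theorem ctx_conv {Γ : List (ETm S)} {M A A' B : ETm S} {s s' : S}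
    (hM : ETyped Ar Rr (A :: Γ) M B) (hA : ETyped Ar Rr Γ A (.sort s))
    (hA' : ETyped Ar Rr Γ A' (.sort s')) (hc : EConv Rr A' A) :
    ETyped Ar Rr (A' :: Γ) M B := by
  have hΔ : EWf Ar Rr (A' :: Γ) := .decl hA'
  have h := hM.sub (σ := ETm.var) hΔ fun n C hn => by
    rw [ETm.sub_var]
    cases n with
    | zero =>
      cases hn
      exact .conv (.var hΔ rfl) (hA.weaken hΔ) (hc.ren _)
    | succ n => exact .var hΔ hn
  rwa [ETm.sub_var, ETm.sub_var] at h

/-- Inversion of EPTS typing. -/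
def Gen (Ar : S → S → Prop) (Rr : S → S → S → Prop) (Γ : List (ETm S)) (T : ETm S) :
    ETm S → Prop
  | .var n => ∃ A, Γ[n]? = some A ∧ EConv Rr (ETm.ren (· + (n + 1)) A) T
  | .sort s => ∃ s', Ar s s' ∧ EConv Rr (.sort s') T
  | .pi s₁ s₂ A B => ∃ s₃, Rr s₁ s₂ s₃ ∧ ETyped Ar Rr Γ A (.sort s₁) ∧
      ETyped Ar Rr (A :: Γ) B (.sort s₂) ∧ EConv Rr (.sort s₃) T
  | .lam s₁ s₂ A B M => ∃ s₃, Rr s₁ s₂ s₃ ∧ ETyped Ar Rr Γ A (.sort s₁) ∧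
      ETyped Ar Rr (A :: Γ) B (.sort s₂) ∧ ETyped Ar Rr (A :: Γ) M B ∧
      EConv Rr (.pi s₁ s₂ A B) T
  | .app s₁ s₂ A B M N => ∃ s₃, Rr s₁ s₂ s₃ ∧ ETyped Ar Rr Γ A (.sort s₁) ∧
      ETyped Ar Rr (A :: Γ) B (.sort s₂) ∧ ETyped Ar Rr Γ N A ∧
      ETyped Ar Rr Γ M (.pi s₁ s₂ A B) ∧ EConv Rr (ETm.substAt 0 N B) T

theorem gen {Γ : List (ETm S)} {M T : ETm S} (h : ETyped Ar Rr Γ M T) : Gen Ar Rr Γ T M := by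
  induction h using ind with
  | sort _ h => exact ⟨_, h, .refl _⟩
  | var _ h => exact ⟨_, h, .refl _⟩
  | @conv Γ M _ _ _ _ _ hc ih _ =>
    cases M with
    | var =>
      obtain ⟨A, hA, h⟩ := ih
      exact ⟨A, hA, h.trans hc⟩
    | sort =>
      obtain ⟨A, hA, h⟩ := ih
      exact ⟨A, hA, h.trans hc⟩
    | pi =>
      obtain ⟨s₃, hR, hA, hB, h⟩ := ih
      exact ⟨s₃, hR, hA, hB, h.trans hc⟩
    | lam =>
      obtain ⟨s₃, hR, hA, hB, hM, h⟩ := ih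
      exact ⟨s₃, hR, hA, hB, hM, h.trans hc⟩
    | app =>
      obtain ⟨s₃, hR, hA, hB, hN, hM, h⟩ := ih
      exact ⟨s₃, hR, hA, hB, hN, hM, h.trans hc⟩
  | pi hR hA hB => exact ⟨_, hR, hA, hB, .refl _⟩
  | lam hR hA hB hM => exact ⟨_, hR, hA, hB, hM, .refl _⟩
  | app hR hA hB hN hM => exact ⟨_, hR, hA, hB, hN, hM, .refl _⟩

/-- Uniqueness of types in functional EPTSs. -/
theorem unique (hfun : FunctionalSpec Ar Rr) {Γ : List (ETm S)} {M A B : ETm S}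
    (hA : ETyped Ar Rr Γ M A) (hB : ETyped Ar Rr Γ M B) : EConv Rr A B := by
  have gA := hA.gen
  have gB := hB.gen
  cases M with
  | var =>
    obtain ⟨C, hC, h⟩ := gA
    obtain ⟨D, hD, h'⟩ := gB
    cases hC.symm.trans hD
    exact h.symm.trans h'
  | sort =>
    obtain ⟨s, hs, h⟩ := gA
    obtain ⟨t, ht, h'⟩ := gB
    cases hfun.1 _ _ _ hs ht
    exact h.symm.trans h'
  | pi =>
    obtain ⟨s, hs, _, _, h⟩ := gA
    obtain ⟨t, ht, _, _, h'⟩ := gB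
    cases hfun.2 _ _ _ _ hs ht
    exact h.symm.trans h'
  | lam =>
    obtain ⟨_, _, _, _, _, h⟩ := gA
    obtain ⟨_, _, _, _, _, h'⟩ := gB
    exact h.symm.trans h'
  | app =>
    obtain ⟨_, _, _, _, _, _, h⟩ := gA
    obtain ⟨_, _, _, _, _, _, h'⟩ := gB
    exact h.symm.trans h'

end ETyped

theorem EWf.lookup {Γ : List (ETm S)} (h : EWf Ar Rr Γ) {n : Nat} {A : ETm S}
    (hn : Γ[n]? = some A) : ∃ s, ETyped Ar Rr Γ (ETm.ren (· + (n + 1)) A) (.sort s) := by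
  induction Γ generalizing n with
  | nil => simp at hn
  | cons B Γ ih =>
    cases id h with
    | decl hB =>
      cases n with
      | zero =>
        cases hn
        exact ⟨_, hB.weaken h⟩
      | succ n =>
        obtain ⟨s, hs⟩ := ih hB.wf hn
        have hs' := hs.weaken h
        rw [ETm.ren_ren] at hs'
        exact ⟨s, hs'⟩

namespace ETyped

theorem type_valid {Γ : List (ETm S)} {M A : ETm S} (h : ETyped Ar Rr Γ M A) :
    ETypeJ Ar Rr Γ A := by
  induction h using ind with
  | sort => exact .inl ⟨_, rfl⟩
  | var hΓ hn => exact .inr (hΓ.lookup hn)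
  | conv _ hB => exact .inr ⟨_, hB⟩
  | pi => exact .inl ⟨_, rfl⟩
  | lam hR hA hB => exact .inr ⟨_, .pi hR hA hB⟩
  | app _ _ hB hN => exact .inr ⟨_, hB.substAt hN⟩

/-- Subject reduction for EPTSs. -/
theorem step {Γ : List (ETm S)} {M A : ETm S} (h : ETyped Ar Rr Γ M A) :
    ∀ {M' : ETm S}, EStep Rr M M' → ETyped Ar Rr Γ M' A := by
  induction h using ind with
  | sort | var =>
    intro M' h
    cases h with
    | base h => obtain ⟨_, _, _, _, _, _, _, _, _, _, h, _⟩ := h; cases h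
  | conv _ hB hc ihM _ => exact fun h => .conv (ihM h) hB hc
  | pi hR hA hB ihA ihB =>
    intro M' h
    cases h with
    | base h => obtain ⟨_, _, _, _, _, _, _, _, _, _, h, _⟩ := h; cases h
    | piA h => exact .pi hR (ihA h) (hB.ctx_conv hA (ihA h) (EConv.of_step h).symm)
    | piB h => exact .pi hR hA (ihB h)
  | lam hR hA hB hM ihA ihB ihM =>
    intro M' h
    cases h with
    | base h => obtain ⟨_, _, _, _, _, _, _, _, _, _, h, _⟩ := h; cases h
    | lamA h =>
      have hc := (EConv.of_step h).symm
      exact .conv (.lam hR (ihA h) (hB.ctx_conv hA (ihA h) hc) (hM.ctx_conv hA (ihA h) hc))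
        (.pi hR hA hB) (.pi hc (.refl _))
    | lamB h =>
      have hc := EConv.of_step h
      exact .conv (.lam hR hA (ihB h) (.conv hM (ihB h) hc)) (.pi hR hA hB)
        (.pi (.refl _) hc.symm)
    | lamM h => exact .lam hR hA hB (ihM h)
  | app hR hA hB hN hM ihA ihB ihN ihM =>
    intro M' h
    cases h with
    | base h =>
      obtain ⟨s₁, s₂, s₃, A, B, A', B', P, Q, hR', e, rfl⟩ := h
      cases e
      obtain ⟨_, _, hA', hB', hP, hc⟩ := hM.gen
      obtain ⟨-, -, hcA, hcB⟩ := hc.pi_inj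
      exact substAt (.conv (hP.ctx_conv hA' hA hcA.symm) hB hcB) hN
    | appA h =>
      have hc := EConv.of_step h
      have hB' := hB.ctx_conv hA (ihA h) hc.symm
      exact .app hR (ihA h) hB' (.conv hN (ihA h) hc)
        (.conv hM (.pi hR (ihA h) hB') (.pi hc (.refl _)))
    | appB h =>
      have hc := EConv.of_step h
      exact .conv (.app hR hA (ihB h) hN (.conv hM (.pi hR hA (ihB h)) (.pi (.refl _) hc)))
        (hB.substAt hN) (hc.symm.substAt_left _)
    | appM h => exact .app hR hA hB hN (ihM h)
    | appN h =>
      exact .conv (.app hR hA hB (ihN h) hM) (hB.substAt hN)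
        ((EPar.refl _).substAt (EStep.ePar h)).eSteps.eConv.symm

theorem steps {Γ : List (ETm S)} {M M' A : ETm S} (h : ETyped Ar Rr Γ M A)
    (hs : ESteps Rr M M') : ETyped Ar Rr Γ M' A := by
  induction hs with
  | refl => exact h
  | tail _ hs ih => exact ih.step hs

/-- Convertible terms have convertible types in functional EPTSs. -/
theorem conv_types (hfun : FunctionalSpec Ar Rr) {Γ : List (ETm S)} {M N A B : ETm S}
    (hM : ETyped Ar Rr Γ M A) (hN : ETyped Ar Rr Γ N B) (hc : EConv Rr M N) : EConv Rr A B := by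
  obtain ⟨P, hMP, hNP⟩ := hc.join
  exact (hM.steps hMP).unique hfun (hN.steps hNP)

/-- Well-typed terms with the same erasure are convertible in functional EPTSs. -/
theorem conv_of_erase_eq (hfun : FunctionalSpec Ar Rr) (M : ETm S) :
    ∀ {Γ : List (ETm S)} {N A B : ETm S}, ETyped Ar Rr Γ M A → ETyped Ar Rr Γ N B →
      epsErase M = epsErase N → EConv Rr M N := by
  induction M with
  | var | sort =>
    intro Γ N A B _ _ e
    cases N <;> simp only [epsErase, reduceCtorEq] at e
    cases e
    exact .refl _
  | pi s₁ s₂ A₁ B₁ ihA ihB =>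
    intro Γ N A B hM hN e
    cases N <;> simp only [epsErase, reduceCtorEq] at e
    injection e with eA eB
    obtain ⟨_, _, hA₁, hB₁, _⟩ := hM.gen
    obtain ⟨_, _, hA₂, hB₂, _⟩ := hN.gen
    have cA := ihA hA₁ hA₂ eA
    have hB₂' := hB₂.ctx_conv hA₂ hA₁ cA
    have cB := ihB hB₁ hB₂' eB
    cases (hA₁.conv_types hfun hA₂ cA).sort_inj
    cases (hB₁.conv_types hfun hB₂' cB).sort_inj
    exact .pi cA cB
  | lam s₁ s₂ A₁ B₁ M₁ ihA _ ihM =>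
    intro Γ N A B hM hN e
    cases N <;> simp only [epsErase, reduceCtorEq] at e
    injection e with eA eM
    obtain ⟨_, _, hA₁, hB₁, hM₁, _⟩ := hM.gen
    obtain ⟨_, _, hA₂, hB₂, hM₂, _⟩ := hN.gen
    have cA := ihA hA₁ hA₂ eA
    have hM₂' := hM₂.ctx_conv hA₂ hA₁ cA
    have cM := ihM hM₁ hM₂' eM
    have cB := hM₁.conv_types hfun hM₂' cM
    cases (hA₁.conv_types hfun hA₂ cA).sort_inj
    cases (hB₁.conv_types hfun (hB₂.ctx_conv hA₂ hA₁ cA) cB).sort_inj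
    exact .lam cA cB cM
  | app s₁ s₂ A₁ B₁ M₁ N₁ _ _ ihM ihN =>
    intro Γ N A B hM hN e
    cases N <;> simp only [epsErase, reduceCtorEq] at e
    injection e with eM eN
    obtain ⟨_, _, _, _, hN₁, hM₁, _⟩ := hM.gen
    obtain ⟨_, _, _, _, hN₂, hM₂, _⟩ := hN.gen
    have cM := ihM hM₁ hM₂ eM
    obtain ⟨rfl, rfl, cA, cB⟩ := (hM₁.conv_types hfun hM₂ cM).pi_inj
    exact .app cA cB cM (ihN hN₁ hN₂ eN)

end ETyped

/-! ## Erasure -/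

theorem epsErase_ren (M : ETm S) :
    ∀ ρ, epsErase (ETm.ren ρ M) = PTm.ren ρ (epsErase M) := by
  induction M <;> intro ρ <;> simp_all [ETm.ren, PTm.ren, epsErase]

theorem epsErase_sub (M : ETm S) :
    ∀ σ, epsErase (ETm.sub σ M) = PTm.sub (fun n => epsErase (σ n)) (epsErase M) := by
  have lift : ∀ σ : Nat → ETm S,
      (fun n => epsErase (ETm.liftSub σ n)) = PTm.liftSub fun n => epsErase (σ n) := by
    intro σ; funext n
    cases n with
    | zero => rfl
    | succ n => exact epsErase_ren _ _
  induction M <;> intro σ <;> simp_all [ETm.sub, PTm.sub, epsErase]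

theorem epsErase_substAt (k : Nat) (N M : ETm S) :
    epsErase (ETm.substAt k N M) = PTm.substAt k (epsErase N) (epsErase M) := by
  rw [ETm.substAt, epsErase_sub, PTm.substAt]
  congr 1
  funext n
  split_ifs
  · rfl
  · exact epsErase_ren _ _
  · rfl

theorem epsErase_eq_sort {M : ETm S} {s : S} (h : epsErase M = .sort s) : M = .sort s := by
  cases M <;> simp_all [epsErase]

theorem epsErase_eq_pi {M : ETm S} {A B : PTm S} (h : epsErase M = .pi A B) :
    ∃ s₁ s₂ A' B', M = .pi s₁ s₂ A' B' ∧ epsErase A' = A ∧ epsErase B' = B := by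
  cases M <;> simp_all [epsErase]

theorem epsErase_eq_lam {M : ETm S} {A P : PTm S} (h : epsErase M = .lam A P) :
    ∃ s₁ s₂ A' B' P', M = .lam s₁ s₂ A' B' P' ∧ epsErase A' = A ∧ epsErase P' = P := by
  cases M <;> simp_all [epsErase]

/-- Many-step reduction of PTS terms. -/
abbrev PSteps : PTm S → PTm S → Prop := Relation.ReflTransGen PBeta

theorem EStep.erase {M N : ETm S} (h : EStep Rr M N) : PSteps (epsErase M) (epsErase N) := by
  unfold EStep at h
  induction h with
  | base h =>
    obtain ⟨s₁, s₂, s₃, A, B, A', B', P, Q, _, rfl, rfl⟩ := h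
    rw [epsErase_substAt]
    exact .single .red
  | piA _ ih => exact ih.lift (PTm.pi · _) fun _ _ => .piA
  | piB _ ih => exact ih.lift (PTm.pi _ ·) fun _ _ => .piB
  | lamA _ ih => exact ih.lift (PTm.lam · _) fun _ _ => .lamA
  | lamB | appA | appB => exact .refl
  | lamM _ ih => exact ih.lift (PTm.lam _ ·) fun _ _ => .lamM
  | appM _ ih => exact ih.lift (PTm.app · _) fun _ _ => .appL
  | appN _ ih => exact ih.lift (PTm.app _ ·) fun _ _ => .appR

theorem ESteps.erase {M N : ETm S} (h : ESteps Rr M N) :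
    PSteps (epsErase M) (epsErase N) := by
  induction h with
  | refl => exact .refl
  | tail _ h ih => exact ih.trans h.erase

theorem PSteps.pConv {M N : PTm S} (h : PSteps M N) : PConv M N := by
  induction h with
  | refl => exact Relation.EqvGen.refl _
  | tail _ h ih => exact Relation.EqvGen.trans _ _ _ ih (Relation.EqvGen.rel _ _ h)

theorem EConv.erase {M N : ETm S} (h : EConv Rr M N) : PConv (epsErase M) (epsErase N) := by
  obtain ⟨P, hM, hN⟩ := h.join
  exact Relation.EqvGen.trans _ _ _ hM.erase.pConv (Relation.EqvGen.symm _ _ hN.erase.pConv)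

/-- The annotation of PTS terms by a fixed sort, a section of the erasure. -/
def annotate (s : S) : PTm S → ETm S
  | .var n => .var n
  | .sort t => .sort t
  | .pi A B => .pi s s (annotate s A) (annotate s B)
  | .lam A M => .lam s s (annotate s A) (.sort s) (annotate s M)
  | .app M N => .app s s (.sort s) (.sort s) (annotate s M) (annotate s N)

theorem epsErase_annotate (s : S) (M : PTm S) : epsErase (annotate s M) = M := by
  induction M <;> simp_all [epsErase, annotate]

theorem annotate_ren (s : S) (M : PTm S) :
    ∀ ρ, annotate s (PTm.ren ρ M) = ETm.ren ρ (annotate s M) := by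
  induction M <;> intro ρ <;> simp_all [ETm.ren, PTm.ren, annotate]

theorem annotate_sub (s : S) (M : PTm S) :
    ∀ σ, annotate s (PTm.sub σ M) = ETm.sub (fun n => annotate s (σ n)) (annotate s M) := by
  have lift : ∀ σ : Nat → PTm S,
      (ETm.liftSub fun n => annotate s (σ n)) = fun n => annotate s (PTm.liftSub σ n) := by
    intro σ; funext n
    cases n with
    | zero => rfl
    | succ n => exact (annotate_ren _ _ _).symm
  induction M <;> intro σ <;> simp_all [ETm.sub, PTm.sub, annotate]

theorem annotate_substAt (s : S) (k : Nat) (N M : PTm S) :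
    annotate s (PTm.substAt k N M) = ETm.substAt k (annotate s N) (annotate s M) := by
  rw [PTm.substAt, annotate_sub, ETm.substAt]
  congr 1
  funext n
  split_ifs
  · rfl
  · exact annotate_ren _ _ _
  · rfl

theorem PBeta.annotate (s : S) {M N : PTm S} (h : PBeta M N) :
    EStep (fun _ _ _ => True) (DKPaper.annotate s M) (DKPaper.annotate s N) := by
  induction h with
  | red => exact .base ⟨s, s, s, _, _, _, _, _, _, trivial, rfl, annotate_substAt _ _ _ _⟩
  | piA _ h => exact .piA h
  | piB _ h => exact .piB h
  | lamA _ h => exact .lamA h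
  | lamM _ h => exact .lamM h
  | appL _ h => exact .appM h
  | appR _ h => exact .appN h

/-- The Church–Rosser property of PTS conversion. -/
theorem PConv.join (s : S) {M N : PTm S} (h : PConv M N) : ∃ P, PSteps M P ∧ PSteps N P := by
  have key : EConv (fun _ _ _ => True) (annotate s M) (annotate s N) := by
    unfold PConv at h
    induction h with
    | rel _ _ h => exact .of_step (h.annotate s)
    | refl _ => exact .refl _
    | symm _ _ _ ih => exact ih.symm
    | trans _ _ _ _ _ ih ih' => exact ih.trans ih'
  obtain ⟨P, hM, hN⟩ := key.join
  have hM' := hM.erase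
  have hN' := hN.erase
  rw [epsErase_annotate] at hM' hN'
  exact ⟨_, hM', hN'⟩

/-- Erasure maps EPTS derivations to PTS derivations. -/
theorem ETyped.erase {Γ : List (ETm S)} {M A : ETm S} (h : ETyped Ar Rr Γ M A) :
    PTyped Ar Rr (Γ.map epsErase) (epsErase M) (epsErase A) := by
  refine ETyped.rec (motive_1 := fun Γ _ => PWf Ar Rr (Γ.map epsErase))
    (motive_2 := fun Γ M A _ => PTyped Ar Rr (Γ.map epsErase) (epsErase M) (epsErase A))
    .empty (fun _ ih => .decl ih) (fun _ hA ih => .sort ih hA) ?_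
    (fun _ _ hc ihM ihB => .conv ihM ihB hc.erase)
    (fun hR _ _ ihA ihB => .pi hR ihA ihB)
    (fun hR _ _ _ ihA ihB ihM => .lam hR ihA ihB ihM) ?_ h
  · intro Γ n A _ hn ih
    rw [epsErase_ren]
    exact .var ih (by simp [hn])
  · intro Γ s₁ s₂ s₃ A B M N _ _ _ _ _ _ _ ihN ihM
    rw [epsErase_substAt]
    exact .app ihM ihN

/-- Reductions of the erasure of a well-typed EPTS term lift to the EPTS. -/
theorem ETyped.lift_step (M : ETm S) :
    ∀ {Γ : List (ETm S)} {T : ETm S} {N : PTm S}, ETyped Ar Rr Γ M T → PBeta (epsErase M) N →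
      ∃ M', EStep Rr M M' ∧ epsErase M' = N := by
  induction M with
  | var | sort => intro Γ T N _ h; cases h
  | pi s₁ s₂ A B ihA ihB =>
    intro Γ T N hM h
    obtain ⟨_, _, hA, hB, _⟩ := hM.gen
    cases h with
    | piA h => obtain ⟨A', hs, rfl⟩ := ihA hA h; exact ⟨_, .piA hs, rfl⟩
    | piB h => obtain ⟨B', hs, rfl⟩ := ihB hB h; exact ⟨_, .piB hs, rfl⟩
  | lam s₁ s₂ A B M ihA _ ihM =>
    intro Γ T N hM h
    obtain ⟨_, _, hA, _, hM, _⟩ := hM.gen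
    cases h with
    | lamA h => obtain ⟨A', hs, rfl⟩ := ihA hA h; exact ⟨_, .lamA hs, rfl⟩
    | lamM h => obtain ⟨M', hs, rfl⟩ := ihM hM h; exact ⟨_, .lamM hs, rfl⟩
  | app s₁ s₂ A B M Q _ _ ihM ihQ =>
    intro Γ T N hM h
    obtain ⟨_, hR, _, _, hQ, hM, _⟩ := hM.gen
    rw [epsErase] at h
    generalize eM : epsErase M = M₀ at h
    cases h with
    | red =>
      obtain ⟨t₁, t₂, A', B', P, rfl, -, rfl⟩ := epsErase_eq_lam eM
      obtain ⟨_, _, _, _, _, hc⟩ := hM.gen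
      obtain ⟨rfl, rfl, -, -⟩ := hc.pi_inj
      exact ⟨_, .base ⟨_, _, _, _, _, _, _, _, _, hR, rfl, rfl⟩, epsErase_substAt _ _ _⟩
    | appL h =>
      subst eM
      obtain ⟨M', hs, rfl⟩ := ihM hM h
      exact ⟨_, .appM hs, rfl⟩
    | appR h =>
      subst eM
      obtain ⟨Q', hs, rfl⟩ := ihQ hQ h
      exact ⟨_, .appN hs, rfl⟩

namespace ETypeJ

theorem lift_steps {Γ : List (ETm S)} {A : ETm S} {C : PTm S} (hA : ETypeJ Ar Rr Γ A)
    (h : PSteps (epsErase A) C) :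
    ∃ A', ESteps Rr A A' ∧ epsErase A' = C ∧ ETypeJ Ar Rr Γ A' := by
  induction h with
  | refl => exact ⟨A, .refl, rfl, hA⟩
  | tail _ h ih =>
    obtain ⟨A', hs, rfl, hA'⟩ := ih
    obtain ⟨s, rfl⟩ | ⟨s, hA'⟩ := hA'
    · cases h
    · obtain ⟨A'', hs', rfl⟩ := hA'.lift_step _ h
      exact ⟨A'', hs.tail hs', rfl, .inr ⟨s, hA'.step hs'⟩⟩

theorem conv_of_erase_eq (hfun : FunctionalSpec Ar Rr) {Γ : List (ETm S)} {A B : ETm S}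
    (hA : ETypeJ Ar Rr Γ A) (hB : ETypeJ Ar Rr Γ B) (e : epsErase A = epsErase B) :
    EConv Rr A B := by
  obtain ⟨s, rfl⟩ | ⟨s, hA⟩ := hA
  · cases epsErase_eq_sort e.symm
    exact .refl _
  obtain ⟨t, rfl⟩ | ⟨t, hB⟩ := hB
  · cases epsErase_eq_sort e
    exact .refl _
  exact hA.conv_of_erase_eq hfun _ hB e

/-- EPTS types with convertible erasures are convertible in functional EPTSs. -/
theorem conv_of_erase_conv (hfun : FunctionalSpec Ar Rr) (s : S) {Γ : List (ETm S)}
    {A B : ETm S} (hA : ETypeJ Ar Rr Γ A) (hB : ETypeJ Ar Rr Γ B)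
    (h : PConv (epsErase A) (epsErase B)) : EConv Rr A B := by
  obtain ⟨C, hAC, hBC⟩ := h.join s
  obtain ⟨A', hAA', eA, hA'⟩ := hA.lift_steps hAC
  obtain ⟨B', hBB', eB, hB'⟩ := hB.lift_steps hBC
  exact (hAA'.eConv.trans (hA'.conv_of_erase_eq hfun hB' (eA.trans eB.symm))).trans
    hBB'.eConv.symm

end ETypeJ

/-! ## Lifting PTS derivations -/

/-- Every PTS derivation lifts to the EPTS over each well-formed lift of its context. -/
theorem PTyped.lift (hfun : FunctionalSpec Ar Rr) {Γ : List (PTm S)} {M A : PTm S}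
    (h : PTyped Ar Rr Γ M A) :
    (∃ Γ', EWf Ar Rr Γ' ∧ Γ'.map epsErase = Γ) ∧
      ∀ Γ', EWf Ar Rr Γ' → Γ'.map epsErase = Γ →
        ∃ M' A', ETyped Ar Rr Γ' M' A' ∧ epsErase M' = M ∧ epsErase A' = A := by
  refine PTyped.rec (motive_1 := fun Γ _ => ∃ Γ', EWf Ar Rr Γ' ∧ Γ'.map epsErase = Γ)
    (motive_2 := fun Γ M A _ => (∃ Γ', EWf Ar Rr Γ' ∧ Γ'.map epsErase = Γ) ∧
      ∀ Γ', EWf Ar Rr Γ' → Γ'.map epsErase = Γ →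
        ∃ M' A', ETyped Ar Rr Γ' M' A' ∧ epsErase M' = M ∧ epsErase A' = A)
    ⟨[], .empty, rfl⟩ ?decl ?sort ?var ?conv ?pi ?lam ?app h
  case decl =>
    rintro Γ A s _ ⟨⟨Γ', hΓ', rfl⟩, ih⟩
    obtain ⟨A', T, hA', rfl, eT⟩ := ih Γ' hΓ' rfl
    cases epsErase_eq_sort eT
    exact ⟨A' :: Γ', .decl hA', rfl⟩
  case sort =>
    exact fun _ hA ih => ⟨ih, fun Γ' hΓ' _ => ⟨_, _, .sort hΓ' hA, rfl, rfl⟩⟩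
  case var =>
    rintro Γ n A _ hn ih
    refine ⟨ih, ?_⟩
    rintro Γ' hΓ' rfl
    rw [List.getElem?_map, Option.map_eq_some_iff] at hn
    obtain ⟨A', hn, rfl⟩ := hn
    exact ⟨_, _, .var hΓ' hn, rfl, epsErase_ren _ _⟩
  case conv =>
    rintro Γ M A B s _ _ hc ⟨hΓ, ihM⟩ ⟨-, ihB⟩
    refine ⟨hΓ, fun Γ' hΓ' e => ?_⟩
    obtain ⟨M', A', hM', rfl, rfl⟩ := ihM Γ' hΓ' e
    obtain ⟨B', T, hB', rfl, eT⟩ := ihB Γ' hΓ' e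
    cases epsErase_eq_sort eT
    exact ⟨M', B', .conv hM' hB' (hM'.type_valid.conv_of_erase_conv hfun s (.inr ⟨s, hB'⟩) hc),
      rfl, rfl⟩
  case pi =>
    rintro Γ s₁ s₂ s₃ A B hR _ _ ⟨hΓ, ihA⟩ ⟨-, ihB⟩
    refine ⟨hΓ, ?_⟩
    rintro Γ' hΓ' rfl
    obtain ⟨A', T, hA', rfl, eT⟩ := ihA Γ' hΓ' rfl
    cases epsErase_eq_sort eT
    obtain ⟨B', T, hB', rfl, eT⟩ := ihB (A' :: Γ') (.decl hA') rfl
    cases epsErase_eq_sort eT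
    exact ⟨_, _, .pi hR hA' hB', rfl, rfl⟩
  case lam =>
    rintro Γ s₁ s₂ s₃ A B M hR _ _ _ ⟨hΓ, ihA⟩ ⟨-, ihB⟩ ⟨-, ihM⟩
    refine ⟨hΓ, ?_⟩
    rintro Γ' hΓ' rfl
    obtain ⟨A', T, hA', rfl, eT⟩ := ihA Γ' hΓ' rfl
    cases epsErase_eq_sort eT
    obtain ⟨B', T, hB', rfl, eT⟩ := ihB (A' :: Γ') (.decl hA') rfl
    cases epsErase_eq_sort eT
    obtain ⟨M', B'', hM', rfl, eB⟩ := ihM (A' :: Γ') (.decl hA') rfl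
    have hc := hM'.type_valid.conv_of_erase_eq hfun (.inr ⟨_, hB'⟩) eB
    exact ⟨_, _, .lam hR hA' hB' (.conv hM' hB' hc), rfl, rfl⟩
  case app =>
    rintro Γ A B M N _ _ ⟨hΓ, ihM⟩ ⟨-, ihN⟩
    refine ⟨hΓ, fun Γ' hΓ' e => ?_⟩
    obtain ⟨M', T, hM', rfl, eT⟩ := ihM Γ' hΓ' e
    obtain ⟨s₁, s₂, A', B', rfl, rfl, rfl⟩ := epsErase_eq_pi eT
    obtain ⟨N', A'', hN', rfl, eA⟩ := ihN Γ' hΓ' e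
    obtain ⟨s, hs⟩ | ⟨s, hT⟩ := hM'.type_valid
    · cases hs
    obtain ⟨_, hR, hA', hB', _⟩ := hT.gen
    have hc := hN'.type_valid.conv_of_erase_eq hfun (.inr ⟨_, hA'⟩) eA
    exact ⟨_, _, .app hR hA' hB' (.conv hN' hA' hc) hM', rfl, epsErase_substAt _ _ _⟩

/-- PTS derivations lift to any given well-formed EPTS context and EPTS type. -/
theorem PTyped.lift_to (hfun : FunctionalSpec Ar Rr) {Γ' : List (ETm S)} {A' : ETm S}
    {M : PTm S} (hΓ' : EWf Ar Rr Γ') (hA' : ETypeJ Ar Rr Γ' A')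
    (h : PTyped Ar Rr (Γ'.map epsErase) M (epsErase A')) :
    ∃ M', ETyped Ar Rr Γ' M' A' ∧ epsErase M' = M := by
  obtain ⟨M', A'', hM', rfl, eA⟩ := (h.lift hfun).2 Γ' hΓ' rfl
  refine ⟨M', ?_, rfl⟩
  obtain ⟨s, rfl⟩ | ⟨s, hA'⟩ := id hA'
  · cases epsErase_eq_sort eA
    exact hM'
  · exact .conv hM' hA' (hM'.type_valid.conv_of_erase_eq hfun (.inr ⟨s, hA'⟩) eA)

/-- Erasure induces a bijection as soon as it is surjective onto the PTS terms of type `|A'|`. -/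
theorem nonempty_equiv_of_lift (hfun : FunctionalSpec Ar Rr) (Γ' : List (ETm S)) (A' : ETm S)
    (hlift : ∀ M, PTyped Ar Rr (Γ'.map epsErase) M (epsErase A') →
      ∃ M', ETyped Ar Rr Γ' M' A' ∧ epsErase M' = M) :
    Nonempty ({M : PTm S // PTyped Ar Rr (Γ'.map epsErase) M (epsErase A')} ≃
      Quotient (Setoid.mk _ (equivI_equivalence Ar Rr Γ' A'))) := by
  let f : Quotient (Setoid.mk _ (equivI_equivalence Ar Rr Γ' A')) →
      {M : PTm S // PTyped Ar Rr (Γ'.map epsErase) M (epsErase A')} :=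
    Quotient.lift (fun x => ⟨epsErase x.1, x.2.erase⟩) fun _ _ h => Subtype.ext h.1
  refine ⟨(Equiv.ofBijective f ⟨?_, ?_⟩).symm⟩
  · rintro ⟨x⟩ ⟨y⟩ h
    have e : epsErase x.1 = epsErase y.1 := congrArg Subtype.val h
    exact Quotient.sound ⟨e, x.2.conv_of_erase_eq hfun _ y.2 e⟩
  · rintro ⟨M, hM⟩
    obtain ⟨M', hM', rfl⟩ := hlift M hM
    exact ⟨Quotient.mk _ ⟨M', hM'⟩, rfl⟩

/-- Equivalence between functional PTSs and EPTSs. -/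
theorem pts_epts_equivalence {S : Type} (Ar : S → S → Prop) (Rr : S → S → S → Prop)
    (hfun : FunctionalSpec Ar Rr)
    {Γ : List (PTm S)} {A : PTm S} (hA : PTypeJ Ar Rr Γ A) :
    ∃ (Γ' : List (ETm S)) (A' : ETm S),
      Γ'.map epsErase = Γ ∧ epsErase A' = A ∧
      Nonempty ({M : PTm S // PTyped Ar Rr Γ M A} ≃
        Quotient (Setoid.mk _ (equivI_equivalence Ar Rr Γ' A'))) := by
  obtain ⟨s, rfl⟩ | ⟨s, hA⟩ := hA
  · by_cases hM : ∃ M, PTyped Ar Rr Γ M (.sort s)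
    · obtain ⟨M, hM⟩ := hM
      obtain ⟨⟨Γ', hΓ', rfl⟩, -⟩ := hM.lift hfun
      exact ⟨Γ', .sort s, rfl, rfl, nonempty_equiv_of_lift hfun Γ' (.sort s) fun M h =>
        h.lift_to hfun hΓ' (.inl ⟨s, rfl⟩)⟩
    · have e : (Γ.map (annotate s)).map epsErase = Γ := by
        simp [Function.comp_def, epsErase_annotate]
      have hequiv := nonempty_equiv_of_lift (Ar := Ar) hfun (Γ.map (annotate s)) (.sort s)
        fun M h => absurd ⟨M, e ▸ h⟩ hM
      rw [e] at hequiv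
      exact ⟨Γ.map (annotate s), .sort s, e, rfl, hequiv⟩
  · obtain ⟨⟨Γ', hΓ', rfl⟩, ih⟩ := hA.lift hfun
    obtain ⟨A', T, hA', rfl, eT⟩ := ih Γ' hΓ' rfl
    cases epsErase_eq_sort eT
    exact ⟨Γ', A', rfl, rfl, nonempty_equiv_of_lift hfun Γ' A' fun M h =>
      h.lift_to hfun hΓ' (.inr ⟨s, hA'⟩)⟩

end DKPaper
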